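/- arXiv:1603.05908 — 6 statements merged into one kernel-verified Lean document; each statement's English description precedes it below -/
import Mathlib

section
/- For the susceptance parameters b12 = 1.612, b13 = −4.649, b14 = −5.472, b23 = −7.504, b24 = 10.05, b34 = −13.571 and zero active power injections (P2 = P3 = P4 = 0), the lossless four-bus power flow system with unity voltage magnitudes has exactly 16 distinct real solutions; among them are the eight solutions with V_{q2} = V_{q3} = V_{q4} = 0 and V_{d2}, V_{d3}, V_{d4} ∈ {1, −1}, and the remaining eight satisfy (V_{q2}, V_{q3}, V_{q4}) ≠ (0,0,0) and come in four pairs related by (V_d, V_q) ↦ (V_d, −V_q). -/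
/-- The lossless four-bus power flow system with unity voltage magnitudes:
slack bus `V_{d1} = 1, V_{q1} = 0`, variables `V_{di}, V_{qi}` for `i = 2,3,4`,
line susceptances `b_{ik}` and active power injections `P_i`. -/
def PFSolT (b12 b13 b14 b23 b24 b34 P2 P3 P4 : ℝ)
    (v : ℝ × ℝ × ℝ × ℝ × ℝ × ℝ) : Prop :=
  match v with
  | (vd2, vq2, vd3, vq3, vd4, vq4) =>
    b23 * (vd3 * vq2 - vd2 * vq3) + b24 * (vd4 * vq2 - vd2 * vq4) + b12 * vq2 = P2 ∧
    b23 * (vd2 * vq3 - vd3 * vq2) + b34 * (vd4 * vq3 - vd3 * vq4) + b13 * vq3 = P3 ∧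
    b24 * (vd2 * vq4 - vd4 * vq2) + b34 * (vd3 * vq4 - vd4 * vq3) + b14 * vq4 = P4 ∧
    vd2 ^ 2 + vq2 ^ 2 = 1 ∧ vd3 ^ 2 + vq3 ^ 2 = 1 ∧ vd4 ^ 2 + vq4 ^ 2 = 1

section Elimination

variable {b12 b13 b14 b23 b24 b34 d2 q2 d3 q3 d4 q4 : ℝ}

lemma PFSolT.slack_balance (h : PFSolT b12 b13 b14 b23 b24 b34 0 0 0 (d2, q2, d3, q3, d4, q4)) :
    b12 * q2 + b13 * q3 + b14 * q4 = 0 := by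
  obtain ⟨h2, h3, h4, -⟩ := h
  linear_combination h2 + h3 + h4

lemma PFSolT.sine_eq_two_three
    (h : PFSolT b12 b13 b14 b23 b24 b34 0 0 0 (d2, q2, d3, q3, d4, q4)) :
    (b23 * b24 * q2 + b23 * b34 * q3 + b24 * b34 * q4) * (d2 * q3 - d3 * q2) =
      (b12 * b34 - b13 * b24) * (q2 * q3) := by
  obtain ⟨h2, h3, -⟩ := h
  linear_combination -b34 * q3 * h2 + b24 * q2 * h3

lemma PFSolT.sine_eq_four_two
    (h : PFSolT b12 b13 b14 b23 b24 b34 0 0 0 (d2, q2, d3, q3, d4, q4)) :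
    (b23 * b24 * q2 + b23 * b34 * q3 + b24 * b34 * q4) * (d4 * q2 - d2 * q4) =
      (b14 * b23 - b12 * b34) * (q4 * q2) := by
  obtain ⟨h2, -, h4, -⟩ := h
  linear_combination b34 * q4 * h2 - b23 * q2 * h4

lemma PFSolT.sine_eq_three_four
    (h : PFSolT b12 b13 b14 b23 b24 b34 0 0 0 (d2, q2, d3, q3, d4, q4)) :
    (b23 * b24 * q2 + b23 * b34 * q3 + b24 * b34 * q4) * (d3 * q4 - d4 * q3) =
      (b13 * b24 - b14 * b23) * (q3 * q4) := by
  obtain ⟨-, h3, h4, -⟩ := h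
  linear_combination -b24 * q4 * h3 + b23 * q3 * h4

lemma eq_zero_of_sine_eqs {L b β γ d2 d3 d4 q3 q4 a c : ℝ} (hb : b ≠ 0) (hβ : β ≠ 0) (hγ : γ ≠ 0)
    (hd : d2 ^ 2 + 0 ^ 2 = 1) (h23 : L * (d2 * q3 - d3 * 0) = a * (0 * q3))
    (h34 : L * (d3 * q4 - d4 * q3) = b * (q3 * q4))
    (h42 : L * (d4 * 0 - d2 * q4) = c * (q4 * 0)) (hbal : β * q3 + γ * q4 = 0) :
    q3 = 0 ∧ q4 = 0 := by
  have hd2 : d2 ≠ 0 := by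
    rintro rfl
    norm_num at hd
  have hL3 : L * q3 = 0 := mul_left_cancel₀ hd2 (by linear_combination h23)
  have hL4 : L * q4 = 0 := mul_left_cancel₀ hd2 (by linear_combination -h42)
  have h : b * (q3 * q4) = 0 := by linear_combination d3 * hL4 - d4 * hL3 - h34
  rcases mul_eq_zero.1 ((mul_eq_zero.1 h).resolve_left hb) with rfl | rfl
  · simpa [hγ] using hbal
  · simpa [hβ] using hbal

/-- At a zero-injection solution with some `V_{qi} ≠ 0`, no `V_{qi}` vanishes. -/
lemma PFSolT.ne_zero (h : PFSolT b12 b13 b14 b23 b24 b34 0 0 0 (d2, q2, d3, q3, d4, q4))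
    (h12 : b12 ≠ 0) (h13 : b13 ≠ 0) (h14 : b14 ≠ 0) (ha : b12 * b34 - b13 * b24 ≠ 0)
    (hb : b13 * b24 - b14 * b23 ≠ 0) (hc : b14 * b23 - b12 * b34 ≠ 0)
    (hq : ¬(q2 = 0 ∧ q3 = 0 ∧ q4 = 0)) : q2 ≠ 0 ∧ q3 ≠ 0 ∧ q4 ≠ 0 := by
  have hbal := h.slack_balance
  have h23 := h.sine_eq_two_three
  have h34 := h.sine_eq_three_four
  have h42 := h.sine_eq_four_two
  obtain ⟨-, -, -, hd2, hd3, hd4⟩ := h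
  refine ⟨?_, ?_, ?_⟩ <;> rintro rfl <;> apply hq
  · have := eq_zero_of_sine_eqs hb h13 h14 hd2 h23 h34 h42 (by linear_combination hbal)
    tauto
  · have := eq_zero_of_sine_eqs hc h14 h12 hd3 h34 h42 h23 (by linear_combination hbal)
    tauto
  · have := eq_zero_of_sine_eqs ha h12 h13 hd4 h42 h23 h34 (by linear_combination hbal)
    tauto

/-- The equations satisfied by the ratios `x = V_{q3} / V_{q2}` and `r = V_{q4} / V_{q2}`. -/
lemma PFSolT.ratio_eqs {x r a b c ℓ : ℝ} (ha : a = b12 * b34 - b13 * b24)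
    (hb : b = b13 * b24 - b14 * b23) (hc : c = b14 * b23 - b12 * b34)
    (hℓ : ℓ = b23 * b24 + b23 * b34 * x + b24 * b34 * r)
    (h : PFSolT b12 b13 b14 b23 b24 b34 0 0 0 (d2, q2, d3, x * q2, d4, r * q2)) (hq : q2 ≠ 0) :
    b12 + b13 * x + b14 * r = 0 ∧ ℓ * (x * d2 - d3) = a * x ∧ ℓ * (d4 - r * d2) = c * r ∧
      2 * a * ℓ * x ^ 2 * d2 = a ^ 2 * x ^ 2 + (x ^ 2 - 1) * ℓ ^ 2 ∧
      ℓ ^ 2 * (b * x ^ 2 * r ^ 2 + c * r ^ 2 + a * x ^ 2) + a * b * c * x ^ 2 * r ^ 2 = 0 := by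
  have hbal := h.slack_balance
  have h23 := h.sine_eq_two_three
  have h42 := h.sine_eq_four_two
  obtain ⟨-, -, -, hd2, hd3, hd4⟩ := h
  have h3 : ℓ * (x * d2 - d3) = a * x := mul_left_cancel₀ (pow_ne_zero 2 hq) (by
    rw [ha, hℓ]
    linear_combination h23)
  have h4 : ℓ * (d4 - r * d2) = c * r := mul_left_cancel₀ (pow_ne_zero 2 hq) (by
    rw [hc, hℓ]
    linear_combination h42)
  have hx : 2 * a * ℓ * x ^ 2 * d2 = a ^ 2 * x ^ 2 + (x ^ 2 - 1) * ℓ ^ 2 := by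
    linear_combination (a * x - ℓ * x * d2 - ℓ * d3) * h3 - ℓ ^ 2 * (hd3 - x ^ 2 * hd2)
  have hr : -(2 * c * ℓ * r ^ 2 * d2) = c ^ 2 * r ^ 2 + (r ^ 2 - 1) * ℓ ^ 2 := by
    linear_combination (ℓ * r * d2 + c * r + ℓ * d4) * h4 - ℓ ^ 2 * (hd4 - r ^ 2 * hd2)
  refine ⟨mul_left_cancel₀ hq (by linear_combination hbal), h3, h4, hx, ?_⟩
  have hsum : a + b + c = 0 := by rw [ha, hb, hc]; ring
  linear_combination c * r ^ 2 * hx + a * x ^ 2 * hr +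
    (ℓ ^ 2 * x ^ 2 * r ^ 2 + a * c * x ^ 2 * r ^ 2) * hsum

/-- A solution of the ratio equations yields a solution of the power flow system. -/
lemma pfSolT_of_ratio_eqs {x r a b c ℓ w m : ℝ} (ha : a = b12 * b34 - b13 * b24)
    (hb : b = b13 * b24 - b14 * b23) (hc : c = b14 * b23 - b12 * b34)
    (hℓ : ℓ = b23 * b24 + b23 * b34 * x + b24 * b34 * r)
    (hr : b12 + b13 * x + b14 * r = 0) (ha0 : a ≠ 0) (hx0 : x ≠ 0) (hℓ0 : ℓ ≠ 0)
    (hw : 2 * a * ℓ * x ^ 2 * w = a ^ 2 * x ^ 2 + (x ^ 2 - 1) * ℓ ^ 2)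
    (hP : ℓ ^ 2 * (b * x ^ 2 * r ^ 2 + c * r ^ 2 + a * x ^ 2) + a * b * c * x ^ 2 * r ^ 2 = 0)
    (hm : w ^ 2 + m ^ 2 = 1) :
    PFSolT b12 b13 b14 b23 b24 b34 0 0 0
      (w, m, x * (w - a / ℓ), x * m, r * (w + c / ℓ), r * m) := by
  obtain ⟨A, hA⟩ : ∃ A, A = a / ℓ := ⟨_, rfl⟩
  obtain ⟨C, hC⟩ : ∃ C, C = c / ℓ := ⟨_, rfl⟩
  rw [← hA, ← hC]
  rw [eq_div_iff hℓ0] at hA hC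
  have hsum : a + b + c = 0 := by rw [ha, hb, hc]; ring
  refine ⟨mul_left_cancel₀ hℓ0 ?_, mul_left_cancel₀ hℓ0 ?_, mul_left_cancel₀ hℓ0 ?_, hm,
    mul_left_cancel₀ (pow_ne_zero 2 hℓ0) ?_,
    mul_left_cancel₀ (mul_ne_zero ha0 (mul_ne_zero (pow_ne_zero 2 hx0) (pow_ne_zero 2 hℓ0))) ?_⟩
  · linear_combination -b23 * m * x * hA + b24 * m * r * hC - b23 * m * x * ha +
      b24 * m * r * hc + b12 * m * hℓ + b23 * b24 * m * hr
  · linear_combination (b23 * m * x + b34 * x * m * r) * hA + b34 * x * m * r * hC +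
      b23 * m * x * ha - b34 * x * m * r * (hb - hsum) + b13 * x * m * hℓ + b23 * b34 * x * m * hr
  · linear_combination -b24 * m * r * hC - b34 * x * m * r * (hA + hC) +
      b34 * x * m * r * (hb - hsum) - b24 * m * r * hc + b14 * r * m * hℓ + b24 * b34 * r * m * hr
  · linear_combination ℓ ^ 2 * x ^ 2 * hm - hw +
      x ^ 2 * (A * ℓ + a - 2 * w * ℓ) * hA
  · linear_combination a * x ^ 2 * ℓ ^ 2 * r ^ 2 * hm + c * r ^ 2 * hw - hP +
      (ℓ ^ 2 * x ^ 2 * r ^ 2 + a * c * x ^ 2 * r ^ 2) * hsum +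
      a * x ^ 2 * r ^ 2 * (C * ℓ + c + 2 * w * ℓ) * hC

end Elimination

/-- The sextic whose roots are the ratios `V_{q3} / V_{q2}` of complex solutions with `V_q ≠ 0`. -/
def ratioPoly (x : ℝ) : ℝ :=
  558195857751135189715854025188306723 * x ^ 6 - 979845628941808381787281428356287248 *
    x ^ 5 + 34862190884658763721617974597924410 * x ^ 4 +
    741777397866613353537110002200546080 * x ^ 3 -
    496222387679145950793707302916147520 * x ^ 2 +
    129334340771601489216883565161280000 * x - 13564405114137779069518793560000000

/-- The derivative of `ratioPoly`. -/
def ratioPolyDeriv (x : ℝ) : ℝ :=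
  3349175146506811138295124151129840338 * x ^ 5 - 4899228144709041908936407141781436240
    * x ^ 4 + 139448763538635054886471898391697640 * x ^ 3 +
    2225332193599840060611330006601638240 * x ^ 2 -
    992444775358291901587414605832295040 * x + 129334340771601489216883565161280000

lemma ratioPoly_neg_left {x : ℝ} (hl : -9/10 ≤ x) (hu : x < 1/5) : ratioPoly x < 0 := by
  have key : ∀ (s t : ℝ) (_ : 0 ≤ s) (_ : 0 < t), 0 <
      174550875161054391639061566407528407869637 * t ^ 6 +
      3762811947301879921688594840727838735368404 * s * t ^ 5 +
      3724365262756519946272218867877689686598820 * s ^ 2 * t ^ 4 +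
      1336250400296741773483698369513172270396320 * s ^ 3 * t ^ 3 +
      236067454976942726321341788095909620765680 * s ^ 4 * t ^ 2 +
      26633517094354441326206104123629369367104 * s ^ 5 * t +
      1834259845000264437669019266890813393088 * s ^ 6 := by
    intros
    positivity
  have h := key (x + 9/10) (1/5 - x) (by linarith) (by linarith)
  unfold ratioPoly
  linarith

lemma ratioPoly_neg_mid_left {x : ℝ} (hl : 1/5 ≤ x) (hu : x < 2/5) : ratioPoly x < 0 := by
  have key : ∀ (s t : ℝ) (_ : 0 ≤ s) (_ : 0 < t), 0 <
      28660310078129131838578426045168959267 * t ^ 6 +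
      127564252445045090178652407059978275464 * s * t ^ 5 +
      275279094100899261669620022970045508370 * s ^ 2 * t ^ 4 +
      340300023986003951394270985362965991120 * s ^ 3 * t ^ 3 +
      230215028716291920978844274157007758880 * s ^ 4 * t ^ 2 +
      76337013119920605362205488067073552064 * s ^ 5 * t +
      9488660797898197258370303292607285408 * s ^ 6 := by
    intros
    positivity
  have h := key (x - 1/5) (2/5 - x) (by linarith) (by linarith)
  unfold ratioPoly
  linarith

lemma ratioPoly_pos_mid {x : ℝ} (hl : 13/25 ≤ x) (hu : x < 57/100) : 0 < ratioPoly x := by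
  have key : ∀ (s t : ℝ) (_ : 0 ≤ s) (_ : 0 < t), 0 <
      141490878090171032534944560754752531667177472 * t ^ 6 +
      1035182020085297192306689915478988645496358912 * s * t ^ 5 +
      2933463164677875324049525399463286555562420480 * s ^ 2 * t ^ 4 +
      4178665549359635780434668965978607496674602240 * s ^ 3 * t ^ 3 +
      3163120351728777840178098933293672571815760880 * s ^ 4 * t ^ 2 +
      1197369921406952910617174785866438097668592232 * s ^ 5 * t +
      173151818165339048083304084031466148086741427 * s ^ 6 := by
    intros
    positivity
  have h := key (x - 13/25) (57/100 - x) (by linarith) (by linarith)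
  unfold ratioPoly
  linarith

lemma ratioPoly_neg_right {x : ℝ} (hl : 7/10 ≤ x) (hu : x < 11/10) : ratioPoly x < 0 := by
  have key : ∀ (s t : ℝ) (_ : 0 ≤ s) (_ : 0 < t), 0 <
      2390747424829733865935549374729428636133 * t ^ 6 +
      30561329306086644272039269528177402015334 * s * t ^ 5 +
      146789137004075294458034543903702634031555 * s ^ 2 * t ^ 4 +
      337846425231128022180810391352699582610420 * s ^ 3 * t ^ 3 +
      384428099029437903885515267748300213778395 * s ^ 4 * t ^ 2 +
      190038040190541396486356797571871463468614 * s ^ 5 * t +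
      22551441036064480992644959338844867310877 * s ^ 6 := by
    intros
    positivity
  have h := key (x - 7/10) (11/10 - x) (by linarith) (by linarith)
  unfold ratioPoly
  linarith

lemma ratioPolyDeriv_neg_left {x : ℝ} (hu : x ≤ -9/10) : ratioPolyDeriv x < 0 := by
  have key : ∀ (s : ℝ) (_ : 0 ≤ s), 0 <
      123432122560706980538828429194666740370481 +
      1030696805482401965916101804929634534892450 * s +
      2318845753463753573159226894492513078921000 * s ^ 2 +
      2245249438559817807362402161647828742090000 * s ^ 3 +
      998525815199484601563223291093285888050000 * s ^ 4 +
      167458757325340556914756207556492016900000 * s ^ 5 := by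
    intros
    positivity
  have h := key (-9/10 - x) (by linarith)
  unfold ratioPolyDeriv
  linarith

lemma ratioPolyDeriv_pos_mid {x : ℝ} (hl : 2/5 ≤ x) (hu : x < 53/100) : 0 < ratioPolyDeriv x := by
  have key : ∀ (s t : ℝ) (_ : 0 ≤ s) (_ : 0 < t), 0 <
      2388313640926944223013374561406749491200000 * t ^ 5 +
      13403988191008824628127451493313862707200000 * s * t ^ 4 +
      28646560955250082928008722113537819737280000 * s ^ 2 * t ^ 3 +
      27421052680587473864867257145577804726936000 * s ^ 3 * t ^ 2 +
      10774440622816534496538055568242388766126600 * s ^ 4 * t +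
      1032102243076953671025867124735500245417409 * s ^ 5 := by
    intros
    positivity
  have h := key (x - 2/5) (53/100 - x) (by linarith) (by linarith)
  unfold ratioPolyDeriv
  linarith

lemma ratioPolyDeriv_neg_mid {x : ℝ} (hl : 14/25 ≤ x) (hu : x < 71/100) : ratioPolyDeriv x < 0 := by
  have key : ∀ (s t : ℝ) (_ : 0 ≤ s) (_ : 0 < t), 0 <
      267741059951945853537397118437376992739328 * t ^ 5 +
      5881434248459262155706271111253978967818240 * s * t ^ 4 +
      24502885292027526980808511814092478218887680 * s ^ 2 * t ^ 3 +
      41104841623074128475710361684912043425666880 * s ^ 3 * t ^ 2 +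
      30468203226751430119293604860246109661022040 * s ^ 4 * t +
      8205455931699760290590605813234679099410803 * s ^ 5 := by
    intros
    positivity
  have h := key (x - 14/25) (71/100 - x) (by linarith) (by linarith)
  unfold ratioPolyDeriv
  linarith

lemma ratioPolyDeriv_pos_right {x : ℝ} (hl : 11/10 ≤ x) : 0 < ratioPolyDeriv x := by
  have key : ∀ (s : ℝ) (_ : 0 ≤ s), 0 <
      6841174246769313816310880192350282450419 +
      142181553988938664785371456267740058688450 * s +
      584731899134767386678323693674959412419000 * s ^ 2 +
      955393209977563271446864135161222313690000 * s ^ 3 +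
      676061758053920967584338784471634280950000 * s ^ 4 +
      167458757325340556914756207556492016900000 * s ^ 5 := by
    intros
    positivity
  have h := key (x - 11/10) (by linarith)
  unfold ratioPolyDeriv
  linarith

/-- `(b23 b24 V_{q2} + b23 b34 V_{q3} + b24 b34 V_{q4}) / V_{q2}` in terms of
`x = V_{q3} / V_{q2}`. -/
noncomputable def lineForm (x : ℝ) : ℝ := 198553541833 / 912 * x - 26355429875 / 228

/-- The numerator of `V_{d2}` as a function of `V_{q3} / V_{q2}`. -/
noncomputable def cosNumer (x : ℝ) : ℝ := 24845998 ^ 2 * x ^ 2 + (x ^ 2 - 1) * lineForm x ^ 2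

/-- The denominator of `V_{d2}` as a function of `V_{q3} / V_{q2}`. -/
noncomputable def cosDenom (x : ℝ) : ℝ := 2 * 24845998 * lineForm x * x ^ 2

lemma cosNumer_sq_lt_left {x : ℝ} (hl : -1 ≤ x) (hu : x < -47/50) :
    cosNumer x ^ 2 < cosDenom x ^ 2 := by
  have key : ∀ (s t : ℝ) (_ : 0 ≤ s) (_ : 0 < t), 0 <
      9923153185454384666800000000 * t ^ 4 +
      30426826572375260553059250000 * s * t ^ 3 +
      32656831341733936569080422500 * s ^ 2 * t ^ 2 +
      13694512305853981591476329200 * s ^ 3 * t +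
      1541709162621690768584155701 * s ^ 4 := by
    intros
    positivity
  have key₂ : ∀ (s t : ℝ) (_ : 0 ≤ s) (_ : 0 < t), 0 <
      9210020943539576846000000000 * t ^ 4 +
      43060033390823413697836750000 * s * t ^ 3 +
      73163565879638442938505817500 * s ^ 2 * t ^ 2 +
      54015699282904328295100586000 * s ^ 3 * t +
      14701791038968952348502519499 * s ^ 4 := by
    intros
    positivity
  have h : cosDenom x - cosNumer x < 0 := by
    have := key (x + 1) (-47/50 - x) (by linarith) (by linarith)
    unfold cosDenom cosNumer lineForm
    linarith
  have h₂ : cosDenom x + cosNumer x < 0 := by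
    have := key₂ (x + 1) (-47/50 - x) (by linarith) (by linarith)
    unfold cosDenom cosNumer lineForm
    linarith
  nlinarith [mul_pos_of_neg_of_neg h h₂]

lemma cosNumer_sq_lt_mid_left {x : ℝ} (hl : 12/25 ≤ x) (hu : x < 493/1000) :
    cosNumer x ^ 2 < cosDenom x ^ 2 := by
  have key : ∀ (s t : ℝ) (_ : 0 ≤ s) (_ : 0 < t), 0 <
      145170577617014219161720586240000 * t ^ 4 +
      607327900250095778556945678336000 * s * t ^ 3 +
      943902644812630650634236002366400 * s ^ 2 * t ^ 2 +
      646558453396624352302461547908160 * s ^ 3 * t +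
      164814257191915079726720875467489 * s ^ 4 := by
    intros
    positivity
  have key₂ : ∀ (s t : ℝ) (_ : 0 ≤ s) (_ : 0 < t), 0 <
      66082675164303260624103669760000 * t ^ 4 +
      195224771447101012924229566464000 * s * t ^ 3 +
      193471051354846161954263064513600 * s ^ 2 * t ^ 2 +
      65504396582910814091939076347840 * s ^ 3 * t +
      1174315536022585774531670708511 * s ^ 4 := by
    intros
    positivity
  have h : cosDenom x - cosNumer x < 0 := by
    have := key (x - 12/25) (493/1000 - x) (by linarith) (by linarith)
    unfold cosDenom cosNumer lineForm
    linarith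
  have h₂ : cosDenom x + cosNumer x < 0 := by
    have := key₂ (x - 12/25) (493/1000 - x) (by linarith) (by linarith)
    unfold cosDenom cosNumer lineForm
    linarith
  nlinarith [mul_pos_of_neg_of_neg h h₂]

lemma cosNumer_sq_lt_mid_right {x : ℝ} (hl : 59/100 ≤ x) (hu : x < 61/100) :
    cosNumer x ^ 2 < cosDenom x ^ 2 := by
  have key : ∀ (s t : ℝ) (_ : 0 ≤ s) (_ : 0 < t), 0 <
      9585122919886051218246543471 * t ^ 4 +
      50393437743717876101105568036 * s * t ^ 3 +
      94897754118089999036204129466 * s ^ 2 * t ^ 2 +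
      76921944683205472787319711076 * s ^ 3 * t +
      22831874612803707771878607951 * s ^ 4 := by
    intros
    positivity
  have key₂ : ∀ (s t : ℝ) (_ : 0 ≤ s) (_ : 0 < t), 0 <
      27408199849908825118440829329 * t ^ 4 +
      112617063424818678645296198364 * s * t ^ 3 +
      173065758102806921156527518534 * s ^ 2 * t ^ 2 +
      117961264560778328316928122524 * s ^ 3 * t +
      30105000809024851549351971249 * s ^ 4 := by
    intros
    positivity
  have h : 0 < cosDenom x - cosNumer x := by
    have := key (x - 59/100) (61/100 - x) (by linarith) (by linarith)
    unfold cosDenom cosNumer lineForm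
    linarith
  have h₂ : 0 < cosDenom x + cosNumer x := by
    have := key₂ (x - 59/100) (61/100 - x) (by linarith) (by linarith)
    unfold cosDenom cosNumer lineForm
    linarith
  nlinarith [mul_pos h h₂]

lemma cosNumer_sq_lt_right {x : ℝ} (hl : 11/10 ≤ x) (hu : x < 6/5) :
    cosNumer x ^ 2 < cosDenom x ^ 2 := by
  have key : ∀ (s t : ℝ) (_ : 0 ≤ s) (_ : 0 < t), 0 <
      28936151599953755747667411 * t ^ 4 +
      99260252653991065126413288 * s * t ^ 3 +
      114628703806257255107838564 * s ^ 2 * t ^ 2 +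
      45995241450214215470233952 * s ^ 3 * t +
      1651215189019840860141376 * s ^ 4 := by
    intros
    positivity
  have key₂ : ∀ (s t : ℝ) (_ : 0 ≤ s) (_ : 0 < t), 0 <
      94979396423004610874782509 * t ^ 4 +
      440707847366311198204854552 * s * t ^ 3 +
      766765641425638495735107996 * s ^ 2 * t ^ 2 +
      592731306402255457852159648 * s ^ 3 * t +
      171733539428897978328123584 * s ^ 4 := by
    intros
    positivity
  have h : 0 < cosDenom x - cosNumer x := by
    have := key (x - 11/10) (6/5 - x) (by linarith) (by linarith)
    unfold cosDenom cosNumer lineForm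
    linarith
  have h₂ : 0 < cosDenom x + cosNumer x := by
    have := key₂ (x - 11/10) (6/5 - x) (by linarith) (by linarith)
    unfold cosDenom cosNumer lineForm
    linarith
  nlinarith [mul_pos h h₂]

lemma hasDerivAt_ratioPoly (x : ℝ) : HasDerivAt ratioPoly (ratioPolyDeriv x) x := by
  have h (n : ℕ) (k : ℝ) := (hasDerivAt_pow n x).const_mul k
  have hsum := ((((((h 6 558195857751135189715854025188306723).sub
    (h 5 979845628941808381787281428356287248)).add
    (h 4 34862190884658763721617974597924410)).add
    (h 3 741777397866613353537110002200546080)).sub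
    (h 2 496222387679145950793707302916147520)).add
    ((hasDerivAt_id x).const_mul 129334340771601489216883565161280000)).sub_const
    13564405114137779069518793560000000
  refine hsum.congr_deriv ?_
  rw [ratioPolyDeriv]
  norm_num
  ring

lemma continuous_ratioPoly : Continuous ratioPoly := by
  unfold ratioPoly
  fun_prop

lemma injOn_ratioPoly_of_pos {D : Set ℝ} (hD : Convex ℝ D) (h : ∀ x ∈ D, 0 < ratioPolyDeriv x) :
    D.InjOn ratioPoly :=
  (strictMonoOn_of_deriv_pos hD continuous_ratioPoly.continuousOn fun x hx => by
    rw [(hasDerivAt_ratioPoly x).deriv]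
    exact h x (interior_subset hx)).injOn

lemma injOn_ratioPoly_of_neg {D : Set ℝ} (hD : Convex ℝ D) (h : ∀ x ∈ D, ratioPolyDeriv x < 0) :
    D.InjOn ratioPoly :=
  (strictAntiOn_of_deriv_neg hD continuous_ratioPoly.continuousOn fun x hx => by
    rw [(hasDerivAt_ratioPoly x).deriv]
    exact h x (interior_subset hx)).injOn

/-- The sextic has exactly four real roots, which lie in the given intervals. -/
lemma exists_ratioPoly_roots : ∃ x₁ x₂ x₃ x₄ : ℝ,
    x₁ ∈ Set.Ioo (-1 : ℝ) (-47/50) ∧ x₂ ∈ Set.Ioo (12/25 : ℝ) (493/1000) ∧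
    x₃ ∈ Set.Ioo (59/100 : ℝ) (61/100) ∧ x₄ ∈ Set.Ioo (11/10 : ℝ) (6/5) ∧
    {x | ratioPoly x = 0} = {x₁, x₂, x₃, x₄} := by
  have hc := continuous_ratioPoly
  obtain ⟨x₁, h₁, z₁⟩ := intermediate_value_Ioo' (a := (-1 : ℝ)) (b := -47/50) (by norm_num)
    hc.continuousOn (show (0 : ℝ) ∈ _ by constructor <;> norm_num [ratioPoly])
  obtain ⟨x₂, h₂, z₂⟩ := intermediate_value_Ioo (a := (12/25 : ℝ)) (b := 493/1000) (by norm_num)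
    hc.continuousOn (show (0 : ℝ) ∈ _ by constructor <;> norm_num [ratioPoly])
  obtain ⟨x₃, h₃, z₃⟩ := intermediate_value_Ioo' (a := (59/100 : ℝ)) (b := 61/100) (by norm_num)
    hc.continuousOn (show (0 : ℝ) ∈ _ by constructor <;> norm_num [ratioPoly])
  obtain ⟨x₄, h₄, z₄⟩ := intermediate_value_Ioo (a := (11/10 : ℝ)) (b := 6/5) (by norm_num)
    hc.continuousOn (show (0 : ℝ) ∈ _ by constructor <;> norm_num [ratioPoly])
  refine ⟨x₁, x₂, x₃, x₄, h₁, h₂, h₃, h₄, ?_⟩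
  ext x
  simp only [Set.mem_ofPred_eq, Set.mem_insert_iff, Set.mem_singleton_iff]
  refine ⟨fun hx => ?_, by rintro (rfl | rfl | rfl | rfl) <;> assumption⟩
  obtain ⟨l₁, u₁⟩ := h₁
  obtain ⟨l₂, u₂⟩ := h₂
  obtain ⟨l₃, u₃⟩ := h₃
  obtain ⟨l₄, u₄⟩ := h₄
  rcases lt_or_ge x (-9/10) with h | h
  · exact .inl <| injOn_ratioPoly_of_neg (convex_Iic (-9/10))
      (fun y hy => ratioPolyDeriv_neg_left hy) h.le (by simp; linarith) (hx.trans z₁.symm)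
  rcases lt_or_ge x (1/5) with h' | h'
  · linarith [ratioPoly_neg_left h h']
  rcases lt_or_ge x (2/5) with h' | h'
  · linarith [ratioPoly_neg_mid_left (by assumption) h']
  rcases lt_or_ge x (13/25) with h' | h'
  · exact .inr <| .inl <| injOn_ratioPoly_of_pos (convex_Ico (2/5) (53/100))
      (fun y hy => ratioPolyDeriv_pos_mid hy.1 hy.2) (by constructor <;> linarith)
      (by constructor <;> linarith) (hx.trans z₂.symm)
  rcases lt_or_ge x (57/100) with h' | h'
  · linarith [ratioPoly_pos_mid (by assumption) h']
  rcases lt_or_ge x (7/10) with h' | h'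
  · exact .inr <| .inr <| .inl <| injOn_ratioPoly_of_neg (convex_Ico (14/25) (71/100))
      (fun y hy => ratioPolyDeriv_neg_mid hy.1 hy.2) (by constructor <;> linarith)
      (by constructor <;> linarith) (hx.trans z₃.symm)
  rcases lt_or_ge x (11/10) with h' | h'
  · linarith [ratioPoly_neg_right (by assumption) h']
  · exact .inr <| .inr <| .inr <| injOn_ratioPoly_of_pos (convex_Ici (11/10))
      (fun y hy => ratioPolyDeriv_pos_right hy) h' l₄.le (hx.trans z₄.symm)

lemma encard_ratioPoly_roots : {x | ratioPoly x = 0}.encard = 4 := by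
  obtain ⟨x₁, x₂, x₃, x₄, ⟨-, h₁⟩, ⟨h₂, h₂'⟩, ⟨h₃, h₃'⟩, ⟨h₄, -⟩, h⟩ := exists_ratioPoly_roots
  rw [h, Set.encard_insert_of_notMem, Set.encard_insert_of_notMem, Set.encard_pair]
  · norm_num
  · exact (by linarith : x₃ < x₄).ne
  · simp only [Set.mem_insert_iff, Set.mem_singleton_iff, not_or]
    exact ⟨(by linarith : x₂ < x₃).ne, (by linarith : x₂ < x₄).ne⟩
  · simp only [Set.mem_insert_iff, Set.mem_singleton_iff, not_or]
    exact ⟨(by linarith : x₁ < x₂).ne, (by linarith : x₁ < x₃).ne, (by linarith : x₁ < x₄).ne⟩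

lemma cosNumer_sq_lt_of_root {x : ℝ} (hx : ratioPoly x = 0) : cosNumer x ^ 2 < cosDenom x ^ 2 := by
  obtain ⟨x₁, x₂, x₃, x₄, h₁, h₂, h₃, h₄, h⟩ := exists_ratioPoly_roots
  have hx' : x ∈ ({x₁, x₂, x₃, x₄} : Set ℝ) := h ▸ hx
  rcases hx' with rfl | rfl | rfl | rfl
  · exact cosNumer_sq_lt_left h₁.1.le h₁.2
  · exact cosNumer_sq_lt_mid_left h₂.1.le h₂.2
  · exact cosNumer_sq_lt_mid_right h₃.1.le h₃.2
  · exact cosNumer_sq_lt_right h₄.1.le h₄.2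

lemma cosDenom_ne_zero_of_root {x : ℝ} (hx : ratioPoly x = 0) : cosDenom x ≠ 0 := by
  intro h
  nlinarith [cosNumer_sq_lt_of_root hx]

/-- `V_{d2}` as a function of `V_{q3} / V_{q2}`. -/
noncomputable def cosValue (x : ℝ) : ℝ := cosNumer x / cosDenom x

lemma cosValue_sq_lt_one {x : ℝ} (hx : ratioPoly x = 0) : cosValue x ^ 2 < 1 := by
  have h := cosDenom_ne_zero_of_root hx
  rw [cosValue, div_pow, div_lt_one (by positivity)]
  exact cosNumer_sq_lt_of_root hx

/-- `V_{q4} / V_{q2}` as a function of `V_{q3} / V_{q2}`. -/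
noncomputable def fourthRatio (x : ℝ) : ℝ := (1612 - 4649 * x) / 5472

lemma ratio_equation_iff (x : ℝ) :
    lineForm x ^ 2 * (-87784338 * x ^ 2 * fourthRatio x ^ 2 + 62938340 * fourthRatio x ^ 2 +
      24845998 * x ^ 2) + 24845998 * -87784338 * 62938340 * x ^ 2 * fourthRatio x ^ 2 = 0 ↔
      ratioPoly x = 0 := by
  have h : lineForm x ^ 2 * (-87784338 * x ^ 2 * fourthRatio x ^ 2 +
      62938340 * fourthRatio x ^ 2 + 24845998 * x ^ 2) +
      24845998 * -87784338 * 62938340 * x ^ 2 * fourthRatio x ^ 2 =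
      -(67 / 12452365467648) * ratioPoly x := by
    unfold lineForm fourthRatio ratioPoly
    ring
  rw [h]
  norm_num

/-- The solution with `V_{q3} / V_{q2} = x` and `V_{q2}` of the sign `e = ±1`. -/
noncomputable def nontrivialSol (p : ℝ × ℝ) : ℝ × ℝ × ℝ × ℝ × ℝ × ℝ :=
  (cosValue p.1, p.2 * √(1 - cosValue p.1 ^ 2),
    p.1 * (cosValue p.1 - 24845998 / lineForm p.1), p.1 * (p.2 * √(1 - cosValue p.1 ^ 2)),
    fourthRatio p.1 * (cosValue p.1 + 62938340 / lineForm p.1),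
    fourthRatio p.1 * (p.2 * √(1 - cosValue p.1 ^ 2)))

lemma pfSolT_scaled_iff (v : ℝ × ℝ × ℝ × ℝ × ℝ × ℝ) :
    PFSolT (1612/1000) (-4649/1000) (-5472/1000) (-7504/1000) (10050/1000) (-13571/1000) 0 0 0 v ↔
      PFSolT 1612 (-4649) (-5472) (-7504) 10050 (-13571) 0 0 0 v := by
  constructor
  · rintro ⟨h2, h3, h4, h⟩
    exact ⟨by linear_combination 1000 * h2, by linear_combination 1000 * h3,
      by linear_combination 1000 * h4, h⟩
  · rintro ⟨h2, h3, h4, h⟩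
    exact ⟨by linear_combination h2 / 1000, by linear_combination h3 / 1000,
      by linear_combination h4 / 1000, h⟩

lemma pfSolT_nontrivialSol {x e : ℝ} (hx : ratioPoly x = 0) (he : e = 1 ∨ e = -1) :
    PFSolT 1612 (-4649) (-5472) (-7504) 10050 (-13571) 0 0 0 (nontrivialSol (x, e)) := by
  have hD := cosDenom_ne_zero_of_root hx
  have hlt := cosValue_sq_lt_one hx
  have hx0 : x ≠ 0 := by
    rintro rfl
    simp [cosDenom] at hD
  have hℓ0 : lineForm x ≠ 0 := by
    intro h
    simp [cosDenom, h] at hD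
  refine pfSolT_of_ratio_eqs (by norm_num) (b := -87784338) (by norm_num) (by norm_num)
    (by rw [lineForm, fourthRatio]; ring) (by rw [fourthRatio]; ring) (by norm_num) hx0 hℓ0
    ?_ ((ratio_equation_iff x).2 hx) ?_
  · change cosDenom x * cosValue x = cosNumer x
    rw [cosValue, mul_div_cancel₀ _ hD]
  · have he2 : e ^ 2 = 1 := by rcases he with rfl | rfl <;> norm_num
    rw [mul_pow, he2, Real.sq_sqrt (by linarith)]
    ring

lemma injOn_nontrivialSol :
    Set.InjOn nontrivialSol ({x | ratioPoly x = 0} ×ˢ {1, -1}) := by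
  rintro ⟨x, e⟩ ⟨hx, he⟩ ⟨y, f⟩ ⟨-, hf⟩ h
  have hs : 0 < √(1 - cosValue x ^ 2) := Real.sqrt_pos.2 (by linarith [cosValue_sq_lt_one hx])
  simp only [nontrivialSol, Prod.mk.injEq] at h
  obtain ⟨hw, h2, -, h3, -⟩ := h
  rw [← hw] at h2 h3
  have hef : e = f := mul_right_cancel₀ hs.ne' h2
  have he0 : e ≠ 0 := by rcases he with rfl | rfl <;> norm_num
  rw [← hef] at h3
  rw [mul_right_cancel₀ (mul_ne_zero he0 hs.ne') h3, hef]

lemma exists_nontrivialSol_eq {v : ℝ × ℝ × ℝ × ℝ × ℝ × ℝ}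
    (h : PFSolT 1612 (-4649) (-5472) (-7504) 10050 (-13571) 0 0 0 v)
    (hq : ¬(v.2.1 = 0 ∧ v.2.2.2.1 = 0 ∧ v.2.2.2.2.2 = 0)) :
    v ∈ nontrivialSol '' ({x | ratioPoly x = 0} ×ˢ {1, -1}) := by
  obtain ⟨w, m, d3, q3, d4, q4⟩ := v
  obtain ⟨hm, -, -⟩ := h.ne_zero (by norm_num) (by norm_num) (by norm_num) (by norm_num)
    (by norm_num) (by norm_num) hq
  obtain ⟨x, rfl⟩ : ∃ x, q3 = x * m := ⟨q3 / m, (div_mul_cancel₀ q3 hm).symm⟩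
  obtain ⟨r, rfl⟩ : ∃ r, q4 = r * m := ⟨q4 / m, (div_mul_cancel₀ q4 hm).symm⟩
  obtain ⟨hr, h3, h4, hw, hP⟩ := h.ratio_eqs (a := 24845998) (b := -87784338) (c := 62938340)
    (by norm_num) (by norm_num) (by norm_num) rfl hm
  obtain rfl : r = fourthRatio x := by
    rw [fourthRatio]
    linear_combination -hr / 5472
  have hℓ : -7504 * 10050 + -7504 * -13571 * x + 10050 * -13571 * fourthRatio x = lineForm x := by
    rw [lineForm, fourthRatio]
    ring
  rw [hℓ] at h3 h4 hw hP
  have hx := (ratio_equation_iff x).1 hP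
  have hD := cosDenom_ne_zero_of_root hx
  have hℓ0 : lineForm x ≠ 0 := by
    intro h
    simp [cosDenom, h] at hD
  obtain rfl : w = cosValue x := by
    rw [cosValue, eq_div_iff hD, mul_comm]
    exact hw
  have hm2 : m ^ 2 = 1 - cosValue x ^ 2 := by linear_combination h.2.2.2.1
  have hd3 : x * (cosValue x - 24845998 / lineForm x) = d3 := by
    field_simp
    linear_combination h3
  have hd4 : fourthRatio x * (cosValue x + 62938340 / lineForm x) = d4 := by
    field_simp
    linear_combination -h4
  rcases le_total 0 m with h0 | h0
  · refine ⟨(x, 1), ⟨hx, by simp⟩, ?_⟩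
    simp only [nontrivialSol, ← hm2, Real.sqrt_sq h0, one_mul, hd3, hd4]
  · refine ⟨(x, -1), ⟨hx, by simp⟩, ?_⟩
    simp only [nontrivialSol, ← hm2, Real.sqrt_sq_eq_abs, abs_of_nonpos h0, neg_mul, one_mul,
      neg_neg, hd3, hd4]

lemma PFSolT.neg_imag {b12 b13 b14 b23 b24 b34 : ℝ} {v : ℝ × ℝ × ℝ × ℝ × ℝ × ℝ}
    (h : PFSolT b12 b13 b14 b23 b24 b34 0 0 0 v) :
    PFSolT b12 b13 b14 b23 b24 b34 0 0 0
      (v.1, -v.2.1, v.2.2.1, -v.2.2.2.1, v.2.2.2.2.1, -v.2.2.2.2.2) := by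
  obtain ⟨h2, h3, h4, hd2, hd3, hd4⟩ := h
  exact ⟨by linear_combination -h2, by linear_combination -h3, by linear_combination -h4,
    by linear_combination hd2, by linear_combination hd3, by linear_combination hd4⟩

/-- The point with `V_d = p` and `V_q = 0`. -/
def realSol (p : ℝ × ℝ × ℝ) : ℝ × ℝ × ℝ × ℝ × ℝ × ℝ := (p.1, 0, p.2.1, 0, p.2.2, 0)

lemma pfSolT_realSol_iff {b12 b13 b14 b23 b24 b34 : ℝ} (p : ℝ × ℝ × ℝ) :
    PFSolT b12 b13 b14 b23 b24 b34 0 0 0 (realSol p) ↔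
      p ∈ ({1, -1} ×ˢ {1, -1} ×ˢ {1, -1} : Set (ℝ × ℝ × ℝ)) := by
  simp [PFSolT, realSol]

lemma encard_realSol_image :
    (realSol '' ({1, -1} ×ˢ {1, -1} ×ˢ {1, -1})).encard = 8 := by
  have hinj : Function.Injective realSol := by
    rintro ⟨a, b, c⟩ ⟨a', b', c'⟩ h
    simpa [realSol] using h
  rw [hinj.injOn.encard_image, Set.encard_prod, Set.encard_prod, Set.encard_pair (by norm_num)]
  norm_num

/-- For the susceptances of Table I (exact rationals) and zero injections, the system
has exactly 16 distinct real solutions; the eight sign-pattern solutions with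
`V_q = 0` are among them, and the set of the remaining eight solutions (those with
`(V_{q2}, V_{q3}, V_{q4}) ≠ (0,0,0)`) has cardinality 8 and is invariant under the
fixed-point-free involution `(V_d, V_q) ↦ (V_d, -V_q)`, hence consists of four
pairs related by this involution. -/
theorem stmt7
    (S : Set (ℝ × ℝ × ℝ × ℝ × ℝ × ℝ))
    (hS : S = {v | PFSolT (1612/1000) (-4649/1000) (-5472/1000) (-7504/1000)
      (10050/1000) (-13571/1000) 0 0 0 v})
    (T : Set (ℝ × ℝ × ℝ × ℝ × ℝ × ℝ))
    (hT : T = {v ∈ S | ¬(v.2.1 = 0 ∧ v.2.2.2.1 = 0 ∧ v.2.2.2.2.2 = 0)}) :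
    S.encard = 16 ∧
    (∀ s2 s3 s4 : ℝ, (s2 = 1 ∨ s2 = -1) → (s3 = 1 ∨ s3 = -1) → (s4 = 1 ∨ s4 = -1) →
      ((s2, (0 : ℝ), s3, (0 : ℝ), s4, (0 : ℝ)) ∈ S)) ∧
    T.encard = 8 ∧
    (∀ v ∈ T, (v.1, -v.2.1, v.2.2.1, -v.2.2.2.1, v.2.2.2.2.1, -v.2.2.2.2.2) ∈ T) := by
  have hT' : T = nontrivialSol '' ({x | ratioPoly x = 0} ×ˢ {1, -1}) := by
    rw [hT, hS]
    refine Set.Subset.antisymm (fun v hv => ?_) ?_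
    · exact exists_nontrivialSol_eq ((pfSolT_scaled_iff v).1 hv.1) hv.2
    · rintro _ ⟨⟨x, e⟩, ⟨hx, he⟩, rfl⟩
      refine ⟨(pfSolT_scaled_iff _).2 (pfSolT_nontrivialSol hx he), fun h => ?_⟩
      have he0 : e ≠ 0 := by rcases he with rfl | rfl <;> norm_num
      exact mul_ne_zero he0 (Real.sqrt_pos.2 (by linarith [cosValue_sq_lt_one hx])).ne' h.1
  have hU : ∀ p, realSol p ∈ S ↔
      p ∈ ({1, -1} ×ˢ {1, -1} ×ˢ {1, -1} : Set (ℝ × ℝ × ℝ)) := by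
    intro p
    rw [hS]
    exact pfSolT_realSol_iff p
  have hST : S = T ∪ realSol '' ({1, -1} ×ˢ {1, -1} ×ˢ {1, -1}) := by
    ext v
    constructor
    · intro hv
      by_cases hq : v.2.1 = 0 ∧ v.2.2.2.1 = 0 ∧ v.2.2.2.2.2 = 0
      · obtain ⟨d2, q2, d3, q3, d4, q4⟩ := v
        obtain ⟨rfl, rfl, rfl⟩ : q2 = 0 ∧ q3 = 0 ∧ q4 = 0 := hq
        exact .inr ⟨(d2, d3, d4), (hU (d2, d3, d4)).1 hv, rfl⟩
      · exact .inl (hT ▸ ⟨hv, hq⟩)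
    · rintro (hv | ⟨p, hp, rfl⟩)
      · rw [hT] at hv
        exact hv.1
      · exact (hU p).2 hp
  have hdisj : Disjoint T (realSol '' ({1, -1} ×ˢ {1, -1} ×ˢ {1, -1})) := by
    rw [Set.disjoint_left]
    rintro _ hv ⟨p, -, rfl⟩
    rw [hT] at hv
    exact hv.2 ⟨rfl, rfl, rfl⟩
  have hT8 : T.encard = 8 := by
    rw [hT', injOn_nontrivialSol.encard_image, Set.encard_prod, encard_ratioPoly_roots,
      Set.encard_pair (by norm_num)]
    norm_num
  refine ⟨?_, fun s2 s3 s4 h2 h3 h4 => (hU (s2, s3, s4)).2 ⟨h2, h3, h4⟩, hT8, fun v hv => ?_⟩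
  · rw [hST, Set.encard_union_eq hdisj, hT8, encard_realSol_image]
    norm_num
  · rw [hT, hS] at hv ⊢
    exact ⟨hv.1.neg_imag, by simpa using hv.2⟩
end

section
/- There exists a nonempty open subset U ⊆ ℝ⁶ of susceptance parameter vectors (b12, b13, b14, b23, b24, b34) such that for every b ∈ U, the lossless four-bus power flow system with unity voltage magnitudes and zero active power injections (P2 = P3 = P4 = 0) has at least 16 distinct real solutions. -/
open Filter Topology

/-- If `S` is lower hemicontinuous at `b₀` at each of finitely many distinct points, then `S b` has
at least that many points for `b` near `b₀`. -/
theorem eventually_le_encard_of_injective {B X ι : Type*} [TopologicalSpace B] [TopologicalSpace X]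
    [T2Space X] [Fintype ι] {S : B → Set X} {b₀ : B} {f : ι → X} (hf : Function.Injective f)
    (hS : ∀ i, ∀ N ∈ 𝓝 (f i), ∀ᶠ b in 𝓝 b₀, ∃ v ∈ N, v ∈ S b) :
    ∀ᶠ b in 𝓝 b₀, (Fintype.card ι : ℕ∞) ≤ (S b).encard := by
  obtain ⟨N, hN, hdisj⟩ := (Set.finite_range f).t2_separation
  have hall : ∀ᶠ b in 𝓝 b₀, ∀ i, ∃ v ∈ N (f i), v ∈ S b :=
    eventually_all.2 fun i => hS i _ ((hN (f i)).2.mem_nhds (hN (f i)).1)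
  filter_upwards [hall] with b hb
  choose g hgN hgS using hb
  have hg : Function.Injective g := by
    intro i j hij
    by_contra hne
    exact Set.disjoint_left.1 (hdisj ⟨i, rfl⟩ ⟨j, rfl⟩ (hf.ne hne)) (hgN i) (hij ▸ hgN j)
  calc (Fintype.card ι : ℕ∞) = (Set.range g).encard := by
        rw [← Set.image_univ, hg.encard_image]; simp
    _ ≤ (S b).encard := Set.encard_le_encard (Set.range_subset_iff.2 hgS)

/-- A nondegenerate zero of `F (b₀, ·)` persists for parameters near `b₀`. -/
theorem eventually_exists_zero_of_injective {B V : Type*} [NormedAddCommGroup B] [NormedSpace ℝ B]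
    [CompleteSpace B] [NormedAddCommGroup V] [NormedSpace ℝ V] [FiniteDimensional ℝ V]
    {F : B × V → V} {F' : B × V →L[ℝ] V} {b₀ : B} {v₀ : V} (hF : HasStrictFDerivAt F F' (b₀, v₀))
    (h0 : F (b₀, v₀) = 0) (hinj : ∀ δ, F' (0, δ) = 0 → δ = 0) {N : Set V} (hN : N ∈ 𝓝 v₀) :
    ∀ᶠ b in 𝓝 b₀, ∃ v ∈ N, F (b, v) = 0 := by
  have : CompleteSpace V := FiniteDimensional.complete ℝ V
  have hsurjV : Function.Surjective (F'.toLinearMap ∘ₗ LinearMap.inr ℝ B V) :=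
    LinearMap.surjective_of_injective ((injective_iff_map_eq_zero _).2 fun δ hδ => hinj δ hδ)
  have hG := hasStrictFDerivAt_fst.prodMk hF
  have hsurj : ((ContinuousLinearMap.fst ℝ B V).prod F').range = ⊤ := by
    refine LinearMap.range_eq_top.2 fun ⟨β, y⟩ => ?_
    obtain ⟨δ, hδ⟩ := hsurjV (y - F' (β, 0))
    refine ⟨(β, δ), Prod.ext rfl ?_⟩
    have hsplit : ((β, δ) : B × V) = (β, 0) + (0, δ) := by simp
    have hδ' : F' (0, δ) = y - F' (β, 0) := hδ
    change F' (β, δ) = y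
    rw [hsplit, map_add, hδ']
    abel
  have hnhds := hG.map_nhds_eq_of_surj hsurj
  rw [h0] at hnhds
  have himage : (fun x : B × V => (x.1, F x)) '' (Set.univ ×ˢ N) ∈ 𝓝 (b₀, (0 : V)) := by
    rw [← hnhds]
    exact image_mem_map (prod_mem_nhds univ_mem hN)
  have htendsto : Tendsto (fun b : B => (b, (0 : V))) (𝓝 b₀) (𝓝 (b₀, 0)) :=
    (Continuous.prodMk_left (0 : V)).tendsto b₀
  filter_upwards [htendsto himage] with b hb
  obtain ⟨⟨b', v⟩, ⟨-, hv⟩, heq⟩ := hb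
  obtain ⟨rfl, hFv⟩ := Prod.mk.inj heq
  exact ⟨v, hv, hFv⟩

/-- The left-hand sides of the power flow equations with zero injections, together with the
magnitude defects, as a function of susceptances and voltages. -/
def powerFlowMap (x : (ℝ × ℝ × ℝ × ℝ × ℝ × ℝ) × (ℝ × ℝ × ℝ × ℝ × ℝ × ℝ)) :
    ℝ × ℝ × ℝ × ℝ × ℝ × ℝ :=
  let ⟨⟨b12, b13, b14, b23, b24, b34⟩, ⟨vd2, vq2, vd3, vq3, vd4, vq4⟩⟩ := x
  (b23 * (vd3 * vq2 - vd2 * vq3) + b24 * (vd4 * vq2 - vd2 * vq4) + b12 * vq2,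
    b23 * (vd2 * vq3 - vd3 * vq2) + b34 * (vd4 * vq3 - vd3 * vq4) + b13 * vq3,
    b24 * (vd2 * vq4 - vd4 * vq2) + b34 * (vd3 * vq4 - vd4 * vq3) + b14 * vq4,
    vd2 ^ 2 + vq2 ^ 2 - 1, vd3 ^ 2 + vq3 ^ 2 - 1, vd4 ^ 2 + vq4 ^ 2 - 1)

theorem powerFlowMap_eq_zero_iff (b v : ℝ × ℝ × ℝ × ℝ × ℝ × ℝ) :
    powerFlowMap (b, v) = 0 ↔
      PFSolT b.1 b.2.1 b.2.2.1 b.2.2.2.1 b.2.2.2.2.1 b.2.2.2.2.2 0 0 0 v := by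
  simp [powerFlowMap, PFSolT, Prod.ext_iff, sub_eq_zero (b := (1 : ℝ))]

theorem contDiff_powerFlowMap : ContDiff ℝ 1 powerFlowMap := by
  unfold powerFlowMap
  fun_prop

/-- The derivative of `powerFlowMap` in the voltages. -/
theorem fderiv_powerFlowMap_apply (b12 b13 b14 b23 b24 b34
    d2 q2 d3 q3 d4 q4 D2 Q2 D3 Q3 D4 Q4 : ℝ) :
    fderiv ℝ powerFlowMap ((b12, b13, b14, b23, b24, b34), (d2, q2, d3, q3, d4, q4))
      (0, (D2, Q2, D3, Q3, D4, Q4)) =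
    (b23 * (D3 * q2 + d3 * Q2 - (D2 * q3 + d2 * Q3)) +
        b24 * (D4 * q2 + d4 * Q2 - (D2 * q4 + d2 * Q4)) + b12 * Q2,
      b23 * (D2 * q3 + d2 * Q3 - (D3 * q2 + d3 * Q2)) +
        b34 * (D4 * q3 + d4 * Q3 - (D3 * q4 + d3 * Q4)) + b13 * Q3,
      b24 * (D2 * q4 + d2 * Q4 - (D4 * q2 + d4 * Q2)) +
        b34 * (D3 * q4 + d3 * Q4 - (D4 * q3 + d4 * Q3)) + b14 * Q4,
      2 * d2 * D2 + 2 * q2 * Q2, 2 * d3 * D3 + 2 * q3 * Q3, 2 * d4 * D4 + 2 * q4 * Q4) := by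
  have hline := ((contDiff_powerFlowMap.differentiable one_ne_zero)
    ((b12, b13, b14, b23, b24, b34), (d2, q2, d3, q3, d4, q4))).hasFDerivAt.hasLineDerivAt
      (0, (D2, Q2, D3, Q3, D4, Q4))
  refine hline.unique ?_
  have haff (a A : ℝ) : HasDerivAt (fun t : ℝ => a + t * A) A 0 := by
    simpa using ((hasDerivAt_id (0 : ℝ)).mul_const A).const_add a
  have hcross (a A c C a' A' c' C' : ℝ) :
      HasDerivAt (fun t : ℝ => (a + t * A) * (c + t * C) - (a' + t * A') * (c' + t * C'))
        (A * c + a * C - (A' * c' + a' * C')) 0 := by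
    simpa using ((haff a A).fun_mul (haff c C)).fun_sub ((haff a' A').fun_mul (haff c' C'))
  have hnormSq (a A c C : ℝ) :
      HasDerivAt (fun t : ℝ => (a + t * A) ^ 2 + (c + t * C) ^ 2 - 1)
        (2 * a * A + 2 * c * C) 0 := by
    simpa using (((haff a A).fun_pow 2).fun_add ((haff c C).fun_pow 2)).sub_const 1
  unfold HasLineDerivAt powerFlowMap
  simp only [Prod.smul_mk, smul_zero,
    Prod.fst_zero, Prod.snd_zero, add_zero, smul_eq_mul]
  exact ((((hcross ..).const_mul b23).fun_add ((hcross ..).const_mul b24)).fun_add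
      ((haff ..).const_mul b12)).prodMk <|
    ((((hcross ..).const_mul b23).fun_add ((hcross ..).const_mul b34)).fun_add
      ((haff ..).const_mul b13)).prodMk <|
    ((((hcross ..).const_mul b24).fun_add ((hcross ..).const_mul b34)).fun_add
      ((haff ..).const_mul b14)).prodMk <|
    (hnormSq ..).prodMk <| (hnormSq ..).prodMk (hnormSq ..)

/-- The susceptances around which sixteen solutions are found. -/
noncomputable def baseSusceptance : ℝ × ℝ × ℝ × ℝ × ℝ × ℝ := (-12 / 7, 1, 1, 1, -1, 0)

/-- The value of `V_{d3} - V_{d4}` at a solution with nonzero `V_{q2}`. -/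
noncomputable def voltageDiff (i : Bool) : ℝ := if i then 4 / 3 else -3 / 4

/-- The value of `V_{d3} + V_{d4}` at a solution with nonzero `V_{q2}`. -/
noncomputable def voltageSum (i j : Bool) : ℝ :=
  if j then √(2 - voltageDiff i ^ 2) else -√(2 - voltageDiff i ^ 2)

/-- The sign encoded by a Boolean. -/
def boolSign (i : Bool) : ℝ := if i then 1 else -1

theorem boolSign_injective : Function.Injective boolSign := by
  intro i j h
  cases i <;> cases j <;> first | rfl | norm_num [boolSign] at h

theorem boolSign_sq (i : Bool) : boolSign i ^ 2 = 1 := by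
  cases i <;> norm_num [boolSign]

theorem voltageDiff_injective : Function.Injective voltageDiff := by
  intro i j h
  cases i <;> cases j <;> first | rfl | norm_num [voltageDiff] at h

/-- The stationarity condition of bus 2. -/
theorem voltageDiff_sq (i : Bool) : voltageDiff i ^ 2 - 1 = 7 / 12 * voltageDiff i := by
  cases i <;> norm_num [voltageDiff]

theorem voltageDiff_ne_zero (i : Bool) : voltageDiff i ≠ 0 := by
  cases i <;> norm_num [voltageDiff]

theorem voltageDiff_sq_lt_two (i : Bool) : voltageDiff i ^ 2 < 2 := by
  cases i <;> norm_num [voltageDiff]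

theorem voltageSum_sq (i j : Bool) : voltageSum i j ^ 2 = 2 - voltageDiff i ^ 2 := by
  have h := Real.sq_sqrt (sub_nonneg.2 (voltageDiff_sq_lt_two i).le)
  cases j <;> simpa [voltageSum] using h

theorem voltageSum_ne_zero (i j : Bool) : voltageSum i j ≠ 0 := by
  intro h
  have := voltageSum_sq i j
  rw [h] at this
  linarith [voltageDiff_sq_lt_two i]

theorem voltageSum_injective (i : Bool) : Function.Injective (voltageSum i) := by
  have h := Real.sqrt_pos.2 (sub_pos.2 (voltageDiff_sq_lt_two i))
  intro j k hjk
  cases j <;> cases k <;> simp only [voltageSum, if_true, Bool.false_eq_true, if_false] at hjk ⊢ <;>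
    linarith

/-- Sixteen solutions at `baseSusceptance`: eight with all voltages real, and eight others. -/
noncomputable def powerFlowPoint : (Bool × Bool × Bool) ⊕ (Bool × Bool × Bool) →
    ℝ × ℝ × ℝ × ℝ × ℝ × ℝ
  | .inl (i, j, k) => (boolSign i, 0, boolSign j, 0, boolSign k, 0)
  | .inr (i, j, k) =>
    let w := voltageDiff i
    let u := voltageSum i j
    let ε := boolSign k
    (w * u, ε * (w ^ 2 - 1), (u + w) / 2, ε * (w - u) / 2, (u - w) / 2, ε * (w + u) / 2)

theorem powerFlowPoint_injective : Function.Injective powerFlowPoint := by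
  have hq2 (i k : Bool) : boolSign k * (voltageDiff i ^ 2 - 1) ≠ 0 := by
    rw [voltageDiff_sq]
    exact mul_ne_zero (by cases k <;> norm_num [boolSign])
      (mul_ne_zero (by norm_num) (voltageDiff_ne_zero i))
  rintro (⟨i, j, k⟩ | ⟨i, j, k⟩) (⟨i', j', k'⟩ | ⟨i', j', k'⟩) h <;>
    simp only [powerFlowPoint, Prod.mk.injEq] at h
  · rw [boolSign_injective h.1, boolSign_injective h.2.2.1, boolSign_injective h.2.2.2.2.1]
  · exact absurd h.2.1.symm (hq2 _ _)
  · exact absurd h.2.1 (hq2 _ _)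
  · obtain ⟨-, h2, h3, -, h4, -⟩ := h
    obtain rfl : i = i' := voltageDiff_injective (by linarith)
    obtain rfl : j = j' := voltageSum_injective i (by linarith)
    have hw : voltageDiff i ^ 2 - 1 ≠ 0 := right_ne_zero_of_mul (hq2 i k)
    rw [boolSign_injective (mul_right_cancel₀ hw h2)]

/-- The solutions with nonzero `V_{q2}` at `baseSusceptance` are nondegenerate. -/
theorem fderiv_powerFlowMap_injective (i j k : Bool) (δ : ℝ × ℝ × ℝ × ℝ × ℝ × ℝ)
    (hδ : fderiv ℝ powerFlowMap (baseSusceptance, powerFlowPoint (.inr (i, j, k))) (0, δ) = 0) :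
    δ = 0 := by
  obtain ⟨D2, Q2, D3, Q3, D4, Q4⟩ := δ
  have hw := voltageDiff_sq i
  have hw0 := voltageDiff_ne_zero i
  have hu := voltageSum_sq i j
  have hu0 := voltageSum_ne_zero i j
  have hε := boolSign_sq k
  have hwr : -12 / 7 * voltageDiff i + 1 / 2 ≠ 0 := by cases i <;> norm_num [voltageDiff]
  simp only [baseSusceptance, powerFlowPoint, fderiv_powerFlowMap_apply, Prod.mk_eq_zero] at hδ
  generalize voltageDiff i = w at *
  generalize voltageSum i j = u at *
  generalize boolSign k = ε at *
  obtain ⟨h2, h3, h4, hm2, hm3, hm4⟩ := hδ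
  have tangent (d q D Q : ℝ) (h1 : d ^ 2 + q ^ 2 = 1) (h : 2 * d * D + 2 * q * Q = 0) :
      ∃ τ, D = -q * τ ∧ Q = d * τ := by
    refine ⟨d * Q - q * D, ?_, ?_⟩
    · linear_combination -D * h1 + d / 2 * h
    · linear_combination -Q * h1 + q / 2 * h
  obtain ⟨τ2, rfl, rfl⟩ := tangent _ _ _ _
    (by linear_combination w ^ 2 * hu + (w ^ 2 - 1) ^ 2 * hε) hm2
  obtain ⟨τ3, rfl, rfl⟩ := tangent _ _ _ _
    (by linear_combination (w - u) ^ 2 / 4 * hε + 1 / 2 * hu) hm3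
  obtain ⟨τ4, rfl, rfl⟩ := tangent _ _ _ _
    (by linear_combination (w + u) ^ 2 / 4 * hε + 1 / 2 * hu) hm4
  have hcos23 : (u + w) / 2 * (w * u) + ε * (w - u) / 2 * (ε * (w ^ 2 - 1)) = (u + w) / 2 := by
    linear_combination w / 2 * hu + (w - u) * (w ^ 2 - 1) / 2 * hε
  have hcos24 : (u - w) / 2 * (w * u) + ε * (w + u) / 2 * (ε * (w ^ 2 - 1)) = (w - u) / 2 := by
    linear_combination w / 2 * hu + (w + u) * (w ^ 2 - 1) / 2 * hε
  have hne : (u + w) * (u - w) ≠ 0 := by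
    have : (u + w) * (u - w) = -(7 / 6) * w := by linear_combination hu - 2 * hw
    rw [this]
    exact mul_ne_zero (by norm_num) hw0
  have hτ3 : 2 * τ3 - τ2 = 0 := by
    refine (mul_eq_zero.1 ?_).resolve_left (left_ne_zero_of_mul hne)
    linear_combination 2 * h3 - 2 * (τ3 - τ2) * hcos23
  have hτ4 : 2 * τ4 - τ2 = 0 := by
    refine (mul_eq_zero.1 ?_).resolve_left (right_ne_zero_of_mul hne)
    linear_combination 2 * h4 + 2 * (τ4 - τ2) * hcos24
  have hτ2 : τ2 = 0 := by
    refine (mul_eq_zero.1 ?_).resolve_left (mul_ne_zero hu0 hwr)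
    linear_combination h2 - (τ2 - τ3) * hcos23 + (τ2 - τ4) * hcos24 + (u + w) / 4 * hτ3
      + (u - w) / 4 * hτ4
  obtain rfl : τ3 = 0 := by linarith
  obtain rfl : τ4 = 0 := by linarith
  simp [hτ2]

theorem eventually_exists_PFSolT_near_powerFlowPoint
    (i : (Bool × Bool × Bool) ⊕ (Bool × Bool × Bool)) :
    ∀ N ∈ 𝓝 (powerFlowPoint i), ∀ᶠ b in 𝓝 baseSusceptance, ∃ v ∈ N,
      v ∈ {v | PFSolT b.1 b.2.1 b.2.2.1 b.2.2.2.1 b.2.2.2.2.1 b.2.2.2.2.2 0 0 0 v} := by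
  intro N hN
  rcases i with ⟨i, j, k⟩ | ⟨i, j, k⟩
  · refine Eventually.of_forall fun b => ⟨_, mem_of_mem_nhds hN, ?_⟩
    simp [powerFlowPoint, PFSolT, boolSign_sq]
  · simp only [Set.mem_ofPred_eq, ← powerFlowMap_eq_zero_iff]
    refine eventually_exists_zero_of_injective
      (contDiff_powerFlowMap.contDiffAt.hasStrictFDerivAt one_ne_zero) ?_
      (fderiv_powerFlowMap_injective i j k) hN
    have hw := voltageDiff_sq i
    have hu := voltageSum_sq i j
    have hε := boolSign_sq k
    simp only [baseSusceptance, powerFlowPoint, powerFlowMap, Prod.mk_eq_zero]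
    generalize voltageDiff i = w at *
    generalize voltageSum i j = u at *
    generalize boolSign k = ε at *
    refine ⟨?_, ?_, ?_, ?_, ?_, ?_⟩
    · linear_combination ε * w * hu - 12 / 7 * ε * hw
    · linear_combination -(ε * w / 2) * hu
    · linear_combination -(ε * w / 2) * hu
    · linear_combination w ^ 2 * hu + (w ^ 2 - 1) ^ 2 * hε
    · linear_combination (w - u) ^ 2 / 4 * hε + 1 / 2 * hu
    · linear_combination (w + u) ^ 2 / 4 * hε + 1 / 2 * hu

/-- There is a nonempty open set `U ⊆ ℝ⁶` of susceptance parameter vectors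
`(b12, b13, b14, b23, b24, b34)` such that for every `b ∈ U` the four-bus system
with unity magnitudes and zero injections has at least 16 distinct real solutions. -/
theorem stmt8 : ∃ U : Set (ℝ × ℝ × ℝ × ℝ × ℝ × ℝ),
    IsOpen U ∧ U.Nonempty ∧
    ∀ b ∈ U, 16 ≤ {v : ℝ × ℝ × ℝ × ℝ × ℝ × ℝ |
      PFSolT b.1 b.2.1 b.2.2.1 b.2.2.2.1 b.2.2.2.2.1 b.2.2.2.2.2 0 0 0 v}.encard := by
  have hev := eventually_le_encard_of_injective powerFlowPoint_injective
    (S := fun b => {v | PFSolT b.1 b.2.1 b.2.2.1 b.2.2.2.1 b.2.2.2.2.1 b.2.2.2.2.2 0 0 0 v})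
    (b₀ := baseSusceptance) eventually_exists_PFSolT_near_powerFlowPoint
  obtain ⟨U, hU, hUo, hbU⟩ := eventually_nhds_iff.1 hev
  refine ⟨U, hUo, ⟨_, hbU⟩, fun b hb => ?_⟩
  simpa using hU b hb
end

section
/- There exists a nonempty open subset W ⊆ ℝ⁹ of parameter vectors (b12, b13, b14, b23, b24, b34, P2, P3, P4) such that for every (b, P) ∈ W, the lossless four-bus power flow system with unity voltage magnitudes has at least 16 distinct real solutions; in particular, W contains parameter vectors whose active power injections P2, P3, P4 are all nonzero. -/
/-- The number of distinct real solutions of the four-bus system with unity magnitudes,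
for a parameter vector `(b12, b13, b14, b23, b24, b34, P2, P3, P4) ∈ ℝ⁹`. -/
noncomputable def numRealSols (p : ℝ × ℝ × ℝ × ℝ × ℝ × ℝ × ℝ × ℝ × ℝ) : ℕ∞ :=
  {v : ℝ × ℝ × ℝ × ℝ × ℝ × ℝ |
    PFSolT p.1 p.2.1 p.2.2.1 p.2.2.2.1 p.2.2.2.2.1 p.2.2.2.2.2.1
      p.2.2.2.2.2.2.1 p.2.2.2.2.2.2.2.1 p.2.2.2.2.2.2.2.2 v}.encard

open Filter Topology

/-- If the partial derivative of `F` in its first argument is onto at a point, then `F(·, b) = y`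
stays solvable near that point for all nearby `b` and `y`. -/
theorem eventually_exists_eq_of_surjective_partial {E B G : Type*}
    [NormedAddCommGroup E] [NormedSpace ℝ E] [CompleteSpace E]
    [NormedAddCommGroup B] [NormedSpace ℝ B] [CompleteSpace B]
    [NormedAddCommGroup G] [NormedSpace ℝ G] [CompleteSpace G]
    {F : E × B → G} {F' : E × B →L[ℝ] G} {x : E} {b : B}
    (hF : HasStrictFDerivAt F F' (x, b)) (hsurj : ∀ y, ∃ d, F' (d, 0) = y)
    {U : Set E} (hU : U ∈ 𝓝 x) :
    ∀ᶠ q : B × G in 𝓝 (b, F (x, b)), ∃ x' ∈ U, F (x', q.1) = q.2 := by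
  have hΦ : HasStrictFDerivAt (fun z : E × B => (z.2, F z))
      ((ContinuousLinearMap.snd ℝ E B).prod F') (x, b) := hasStrictFDerivAt_snd.prodMk hF
  have hrange : ((ContinuousLinearMap.snd ℝ E B).prod F').range = ⊤ := by
    rw [LinearMap.range_eq_top]
    rintro ⟨c, y⟩
    obtain ⟨d, hd⟩ := hsurj (y - F' (0, c))
    refine ⟨(d, c), ?_⟩
    have hsplit : F' (d, c) = F' (d, 0) + F' (0, c) := by rw [← map_add]; simp
    simp [hsplit, hd]
  have hmap := hΦ.map_nhds_eq_of_surj hrange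
  have hV : {z : E × B | z.1 ∈ U} ∈ 𝓝 (x, b) := continuous_fst.continuousAt hU
  have himage := image_mem_map (m := fun z : E × B => (z.2, F z)) hV
  rw [hmap] at himage
  filter_upwards [himage]
  rintro _ ⟨⟨x', c⟩, hx', rfl⟩
  exact ⟨x', hx', rfl⟩

/-- The active power injections at the buses `2, 3, 4` as functions of the voltage angles
and the susceptances `(b12, b13, b14, b23, b24, b34)`. -/
noncomputable def angleInjection
    (z : (ℝ × ℝ × ℝ) × (ℝ × ℝ × ℝ × ℝ × ℝ × ℝ)) : ℝ × ℝ × ℝ :=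
  match z with
  | ((t2, t3, t4), (b12, b13, b14, b23, b24, b34)) =>
    (b23 * Real.sin (t2 - t3) + b24 * Real.sin (t2 - t4) + b12 * Real.sin t2,
     b23 * Real.sin (t3 - t2) + b34 * Real.sin (t3 - t4) + b13 * Real.sin t3,
     b24 * Real.sin (t4 - t2) + b34 * Real.sin (t4 - t3) + b14 * Real.sin t4)

/-- The rectangular voltage coordinates belonging to voltage angles. -/
noncomputable def voltageOfAngles (t : ℝ × ℝ × ℝ) : ℝ × ℝ × ℝ × ℝ × ℝ × ℝ :=
  (Real.cos t.1, Real.sin t.1, Real.cos t.2.1, Real.sin t.2.1, Real.cos t.2.2, Real.sin t.2.2)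

/-- The symmetric matrix with off-diagonal entries `-c23, -c24, -c34` and row sums
`c12, c13, c14`: the weighted Laplacian of the four-bus network, grounded at the slack bus. -/
def groundedLaplacian (c12 c13 c14 c23 c24 c34 : ℝ) : Matrix (Fin 3) (Fin 3) ℝ :=
  !![c12 + c23 + c24, -c23, -c24; -c23, c13 + c23 + c34, -c34; -c24, -c34, c14 + c24 + c34]

theorem det_groundedLaplacian (c12 c13 c14 c23 c24 c34 : ℝ) :
    (groundedLaplacian c12 c13 c14 c23 c24 c34).det =
      (c12 + c23 + c24) * ((c13 + c23 + c34) * (c14 + c24 + c34) - c34 ^ 2)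
        - c23 ^ 2 * (c14 + c24 + c34) - 2 * c23 * c24 * c34 - c24 ^ 2 * (c13 + c23 + c34) := by
  simp [groundedLaplacian, Matrix.det_fin_three]
  ring

theorem contDiff_angleInjection : ContDiff ℝ 1 angleInjection := by
  unfold angleInjection
  fun_prop

theorem pfSolT_voltageOfAngles {b12 b13 b14 b23 b24 b34 P2 P3 P4 : ℝ} {t : ℝ × ℝ × ℝ} :
    PFSolT b12 b13 b14 b23 b24 b34 P2 P3 P4 (voltageOfAngles t) ↔
      angleInjection (t, (b12, b13, b14, b23, b24, b34)) = (P2, P3, P4) := by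
  obtain ⟨t2, t3, t4⟩ := t
  simp only [PFSolT, voltageOfAngles, angleInjection, Prod.mk.injEq, Real.sin_sub,
    Real.cos_sq_add_sin_sq, and_true]
  refine and_congr ?_ (and_congr ?_ ?_) <;> ring_nf

theorem exists_voltageOfAngles_eq {vd2 vq2 vd3 vq3 vd4 vq4 : ℝ} (h2 : vd2 ^ 2 + vq2 ^ 2 = 1)
    (h3 : vd3 ^ 2 + vq3 ^ 2 = 1) (h4 : vd4 ^ 2 + vq4 ^ 2 = 1) :
    ∃ t, voltageOfAngles t = (vd2, vq2, vd3, vq3, vd4, vq4) := by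
  have key : ∀ x y : ℝ, x ^ 2 + y ^ 2 = 1 → ∃ t, Real.cos t = x ∧ Real.sin t = y := by
    intro x y h
    have hnorm : ‖(⟨x, y⟩ : ℂ)‖ = 1 := by
      rw [Complex.norm_def, Complex.normSq_mk, ← sq, ← sq, h, Real.sqrt_one]
    have hne : (⟨x, y⟩ : ℂ) ≠ 0 := by
      rw [← norm_ne_zero_iff, hnorm]
      exact one_ne_zero
    exact ⟨Complex.arg ⟨x, y⟩, by rw [Complex.cos_arg hne, hnorm, div_one],
      by rw [Complex.sin_arg, hnorm, div_one]⟩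
  obtain ⟨t2, hc2, hs2⟩ := key _ _ h2
  obtain ⟨t3, hc3, hs3⟩ := key _ _ h3
  obtain ⟨t4, hc4, hs4⟩ := key _ _ h4
  exact ⟨(t2, t3, t4), by simp [voltageOfAngles, *]⟩

theorem fderiv_angleInjection_apply (t2 t3 t4 b12 b13 b14 b23 b24 b34 d2 d3 d4 : ℝ) :
    fderiv ℝ angleInjection ((t2, t3, t4), (b12, b13, b14, b23, b24, b34)) ((d2, d3, d4), 0) =
      (b23 * (Real.cos (t2 - t3) * (d2 - d3)) + b24 * (Real.cos (t2 - t4) * (d2 - d4))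
          + b12 * (Real.cos t2 * d2),
       b23 * (Real.cos (t3 - t2) * (d3 - d2)) + b34 * (Real.cos (t3 - t4) * (d3 - d4))
          + b13 * (Real.cos t3 * d3),
       b24 * (Real.cos (t4 - t2) * (d4 - d2)) + b34 * (Real.cos (t4 - t3) * (d4 - d3))
          + b14 * (Real.cos t4 * d4)) := by
  have hdiff := (contDiff_angleInjection.differentiable one_ne_zero
    ((t2, t3, t4), (b12, b13, b14, b23, b24, b34))).hasFDerivAt
  have hlin : ∀ t d : ℝ, HasDerivAt (fun s : ℝ => t + s * d) d 0 := fun t d => by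
    simpa using ((hasDerivAt_id (0 : ℝ)).mul_const d).const_add t
  have hsin : ∀ t d : ℝ,
      HasDerivAt (fun s : ℝ => Real.sin (t + s * d)) (Real.cos t * d) 0 := fun t d => by
    simpa using (hlin t d).sin
  have hsub : ∀ t d t' d' : ℝ, HasDerivAt (fun s : ℝ => Real.sin (t + s * d - (t' + s * d')))
      (Real.cos (t - t') * (d - d')) 0 := fun t d t' d' => by
    simpa using ((hlin t d).sub (hlin t' d')).sin
  have hcurve : HasDerivAt (fun s : ℝ => (((t2 + s * d2, t3 + s * d3, t4 + s * d4),
      (b12, b13, b14, b23, b24, b34)) : (ℝ × ℝ × ℝ) × (ℝ × ℝ × ℝ × ℝ × ℝ × ℝ)))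
      ((d2, d3, d4), 0) 0 :=
    ((hlin t2 d2).prodMk ((hlin t3 d3).prodMk (hlin t4 d4))).prodMk (hasDerivAt_const _ _)
  have hcomp := HasFDerivAt.comp_hasDerivAt (l := angleInjection) (0 : ℝ)
    (by simpa using hdiff) hcurve
  refine hcomp.unique ?_
  exact ((((hsub t2 d2 t3 d3).const_mul b23).add ((hsub t2 d2 t4 d4).const_mul b24)).add
      ((hsin t2 d2).const_mul b12)).prodMk
    (((((hsub t3 d3 t2 d2).const_mul b23).add ((hsub t3 d3 t4 d4).const_mul b34)).add
      ((hsin t3 d3).const_mul b13)).prodMk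
    ((((hsub t4 d4 t2 d2).const_mul b24).add ((hsub t4 d4 t3 d3).const_mul b34)).add
      ((hsin t4 d4).const_mul b14)))

/-- A solution of the power flow system at which the Jacobian in the angles is invertible. -/
def IsNondegenerateSol (b12 b13 b14 b23 b24 b34 P2 P3 P4 : ℝ)
    (v : ℝ × ℝ × ℝ × ℝ × ℝ × ℝ) : Prop :=
  PFSolT b12 b13 b14 b23 b24 b34 P2 P3 P4 v ∧
    match v with
    | (vd2, vq2, vd3, vq3, vd4, vq4) =>
      (groundedLaplacian (b12 * vd2) (b13 * vd3) (b14 * vd4) (b23 * (vd2 * vd3 + vq2 * vq3))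
        (b24 * (vd2 * vd4 + vq2 * vq4)) (b34 * (vd3 * vd4 + vq3 * vq4))).det ≠ 0

theorem surjective_fderiv_angleInjection {b12 b13 b14 b23 b24 b34 P2 P3 P4 : ℝ} {t : ℝ × ℝ × ℝ}
    (h : IsNondegenerateSol b12 b13 b14 b23 b24 b34 P2 P3 P4 (voltageOfAngles t))
    (y : ℝ × ℝ × ℝ) :
    ∃ d, fderiv ℝ angleInjection (t, (b12, b13, b14, b23, b24, b34)) (d, 0) = y := by
  obtain ⟨t2, t3, t4⟩ := t
  obtain ⟨y2, y3, y4⟩ := y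
  have hdet := h.2
  simp only [voltageOfAngles, ← Real.cos_sub] at hdet
  obtain ⟨d, hd⟩ := Matrix.mulVec_surjective_iff_isUnit.2
    ((Matrix.isUnit_iff_isUnit_det _).2 hdet.isUnit) ![y2, y3, y4]
  have e2 := congrFun hd 0
  have e3 := congrFun hd 1
  have e4 := congrFun hd 2
  simp [groundedLaplacian, Matrix.mulVec, dotProduct, Fin.sum_univ_three] at e2 e3 e4
  refine ⟨(d 0, d 1, d 2), ?_⟩
  rw [fderiv_angleInjection_apply, ← Real.cos_neg (t3 - t2), ← Real.cos_neg (t4 - t2),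
    ← Real.cos_neg (t4 - t3), neg_sub, neg_sub, neg_sub]
  refine Prod.ext ?_ (Prod.ext ?_ ?_)
  · dsimp only
    linear_combination e2
  · dsimp only
    linear_combination e3
  · dsimp only
    linear_combination e4

/-- Nondegenerate solutions persist under small perturbations of the parameters. -/
theorem IsNondegenerateSol.eventually_exists {b12 b13 b14 b23 b24 b34 P2 P3 P4 : ℝ}
    {v : ℝ × ℝ × ℝ × ℝ × ℝ × ℝ} (h : IsNondegenerateSol b12 b13 b14 b23 b24 b34 P2 P3 P4 v)
    {U : Set (ℝ × ℝ × ℝ × ℝ × ℝ × ℝ)} (hU : U ∈ 𝓝 v) :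
    ∀ᶠ p : ℝ × ℝ × ℝ × ℝ × ℝ × ℝ × ℝ × ℝ × ℝ in 𝓝 (b12, b13, b14, b23, b24, b34, P2, P3, P4),
      ∃ v' ∈ U, PFSolT p.1 p.2.1 p.2.2.1 p.2.2.2.1 p.2.2.2.2.1 p.2.2.2.2.2.1
        p.2.2.2.2.2.2.1 p.2.2.2.2.2.2.2.1 p.2.2.2.2.2.2.2.2 v' := by
  obtain ⟨t, rfl⟩ : ∃ t, voltageOfAngles t = v :=
    exists_voltageOfAngles_eq h.1.2.2.2.1 h.1.2.2.2.2.1 h.1.2.2.2.2.2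
  have hcont : Continuous voltageOfAngles := by
    unfold voltageOfAngles
    fun_prop
  have hev := eventually_exists_eq_of_surjective_partial
    (contDiff_angleInjection.contDiffAt.hasStrictFDerivAt one_ne_zero)
    (surjective_fderiv_angleInjection h) (hcont.continuousAt hU)
  rw [pfSolT_voltageOfAngles.1 h.1] at hev
  have hsplit : Continuous fun p : ℝ × ℝ × ℝ × ℝ × ℝ × ℝ × ℝ × ℝ × ℝ =>
      ((p.1, p.2.1, p.2.2.1, p.2.2.2.1, p.2.2.2.2.1, p.2.2.2.2.2.1), p.2.2.2.2.2.2) := by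
    fun_prop
  have htendsto := hsplit.tendsto (b12, b13, b14, b23, b24, b34, P2, P3, P4)
  filter_upwards [htendsto.eventually hev]
  rintro p ⟨t', ht', heq⟩
  exact ⟨voltageOfAngles t', ht', pfSolT_voltageOfAngles.2 heq⟩

/-- The number of real solutions near a parameter vector is at least the number of
nondegenerate solutions there. -/
theorem eventually_card_le_numRealSols {ι : Type*} [Finite ι]
    {b12 b13 b14 b23 b24 b34 P2 P3 P4 : ℝ} {f : ι → ℝ × ℝ × ℝ × ℝ × ℝ × ℝ}
    (hf : Function.Injective f)
    (hsol : ∀ i, IsNondegenerateSol b12 b13 b14 b23 b24 b34 P2 P3 P4 (f i)) :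
    ∀ᶠ p in 𝓝 (b12, b13, b14, b23, b24, b34, P2, P3, P4), ENat.card ι ≤ numRealSols p := by
  obtain ⟨U, hU, hdisj⟩ := (Set.finite_range f).t2_separation
  have hev := eventually_all.2 fun i =>
    (hsol i).eventually_exists ((hU (f i)).2.mem_nhds (hU (f i)).1)
  filter_upwards [hev] with p hp
  choose g hgU hg using hp
  have hinj : Function.Injective g := fun i j hij => hf <|
    hdisj.elim_set ⟨i, rfl⟩ ⟨j, rfl⟩ (g i) (hgU i) (hij ▸ hgU j)
  refine hinj.encard_range.trans ?_
  exact Set.encard_le_encard (Set.range_subset_iff.2 hg)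

/-- The two signs. -/
def signValue : Fin 2 → ℝ := ![1, -1]

theorem signValue_injective : Function.Injective signValue := by
  intro i j h
  fin_cases i <;> fin_cases j <;> first | rfl | (exfalso; revert h; norm_num [signValue])

theorem signValue_sq (i : Fin 2) : signValue i ^ 2 = 1 := by
  fin_cases i <;> norm_num [signValue]

/-- The values of `V_{d2}` at the solutions with nonzero quadrature components. -/
noncomputable def cosTwo : Fin 4 → ℝ := ![-349 / 351, -421 / 429, -453 / 572, -1187 / 1188]

/-- The values of `V_{d3}` at the solutions with nonzero quadrature components. -/
noncomputable def cosThree : Fin 4 → ℝ := ![-101 / 585, -19 / 117, 177 / 520, 23 / 72]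

/-- The values of `V_{q3} / V_{q2}` at the solutions with nonzero quadrature components. -/
noncomputable def ratioThree : Fin 4 → ℝ := ![-231 / 25, -77 / 15, 77 / 50, 231 / 10]

/-- The values of `V_{d4}` at the solutions with nonzero quadrature components. -/
noncomputable def cosFour : Fin 4 → ℝ := ![107 / 135, 13 / 21, 39 / 80, -413 / 432]

/-- The values of `V_{q4} / V_{q2}` at the solutions with nonzero quadrature components. -/
noncomputable def ratioFour : Fin 4 → ℝ := ![143 / 25, 143 / 35, 143 / 100, -143 / 20]

theorem cosTwo_injective : Function.Injective cosTwo := by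
  intro i j h
  fin_cases i <;> fin_cases j <;> first | rfl | (exfalso; revert h; norm_num [cosTwo])

theorem cosTwo_sq_lt_one (k : Fin 4) : cosTwo k ^ 2 < 1 := by
  fin_cases k <;> norm_num [cosTwo]

theorem isNondegenerateSol_signs (i j k : Fin 2) :
    IsNondegenerateSol (-1) (15 / 77) (70 / 143) (5 / 26) (35 / 81) 0 0 0 0
      (signValue i, 0, signValue j, 0, signValue k, 0) := by
  refine ⟨by simp [PFSolT, signValue_sq], ?_⟩
  fin_cases i <;> fin_cases j <;> fin_cases k <;>
    norm_num [signValue, det_groundedLaplacian]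

theorem isNondegenerateSol_of_sq_eq {k : Fin 4} {q : ℝ} (hq : q ^ 2 = 1 - cosTwo k ^ 2) :
    IsNondegenerateSol (-1) (15 / 77) (70 / 143) (5 / 26) (35 / 81) 0 0 0 0
      (cosTwo k, q, cosThree k, ratioThree k * q, cosFour k, ratioFour k * q) := by
  refine ⟨?_, ?_⟩
  · simp only [PFSolT, mul_pow, hq]
    fin_cases k <;> norm_num [cosTwo, cosThree, ratioThree, cosFour, ratioFour] <;>
      refine ⟨?_, ?_, ?_⟩ <;> ring
  · have hprod : ∀ r : ℝ, q * (r * q) = r * (1 - cosTwo k ^ 2) := fun r => by rw [← hq]; ring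
    simp only [hprod]
    fin_cases k <;> norm_num [cosTwo, cosThree, ratioThree, cosFour, ratioFour,
      det_groundedLaplacian]

/-- Sixteen voltage vectors: eight with vanishing quadrature components, and four pairs related
by reversing all angles. -/
noncomputable def sixteenSols :
    (Fin 2 × Fin 2 × Fin 2) ⊕ (Fin 4 × Fin 2) → ℝ × ℝ × ℝ × ℝ × ℝ × ℝ
  | .inl (i, j, k) => (signValue i, 0, signValue j, 0, signValue k, 0)
  | .inr (k, i) =>
    let q := signValue i * Real.sqrt (1 - cosTwo k ^ 2)
    (cosTwo k, q, cosThree k, ratioThree k * q, cosFour k, ratioFour k * q)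

theorem sixteenSols_injective : Function.Injective sixteenSols := by
  rintro (⟨i, j, k⟩ | ⟨k, i⟩) (⟨i', j', k'⟩ | ⟨k', i'⟩) h <;>
    simp only [sixteenSols, Prod.mk.injEq] at h
  · rw [signValue_injective h.1, signValue_injective h.2.2.1, signValue_injective h.2.2.2.2.1]
  · have hlt := cosTwo_sq_lt_one k'
    rw [← h.1, signValue_sq] at hlt
    exact absurd hlt (lt_irrefl _)
  · have hlt := cosTwo_sq_lt_one k
    rw [h.1, signValue_sq] at hlt
    exact absurd hlt (lt_irrefl _)
  · obtain rfl := cosTwo_injective h.1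
    have hne := (Real.sqrt_pos.2 (sub_pos.2 (cosTwo_sq_lt_one k))).ne'
    rw [signValue_injective (mul_right_cancel₀ hne h.2.1)]

theorem isNondegenerateSol_sixteenSols (x : (Fin 2 × Fin 2 × Fin 2) ⊕ (Fin 4 × Fin 2)) :
    IsNondegenerateSol (-1) (15 / 77) (70 / 143) (5 / 26) (35 / 81) 0 0 0 0 (sixteenSols x) := by
  rcases x with ⟨i, j, k⟩ | ⟨k, i⟩
  · exact isNondegenerateSol_signs i j k
  · refine isNondegenerateSol_of_sq_eq ?_
    rw [mul_pow, signValue_sq, one_mul, Real.sq_sqrt (sub_pos.2 (cosTwo_sq_lt_one k)).le]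

/-- There is a nonempty open set `W ⊆ ℝ⁹` of parameter vectors
`(b12, b13, b14, b23, b24, b34, P2, P3, P4)` such that every parameter vector in `W`
yields at least 16 distinct real solutions; moreover `W` contains parameter vectors
whose active power injections `P2, P3, P4` are all nonzero. -/
theorem stmt9 : ∃ W : Set (ℝ × ℝ × ℝ × ℝ × ℝ × ℝ × ℝ × ℝ × ℝ),
    IsOpen W ∧ W.Nonempty ∧
    (∀ p ∈ W, 16 ≤ numRealSols p) ∧
    (∃ p ∈ W, p.2.2.2.2.2.2.1 ≠ 0 ∧ p.2.2.2.2.2.2.2.1 ≠ 0 ∧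
      p.2.2.2.2.2.2.2.2 ≠ 0) := by
  have hcard : ENat.card ((Fin 2 × Fin 2 × Fin 2) ⊕ (Fin 4 × Fin 2)) = 16 := by
    rw [ENat.card_eq_coe_fintype_card]
    rfl
  have hev := eventually_card_le_numRealSols sixteenSols_injective isNondegenerateSol_sixteenSols
  rw [hcard] at hev
  have hsub : interior {p | (16 : ℕ∞) ≤ numRealSols p} ⊆ {p | (16 : ℕ∞) ≤ numRealSols p} :=
    interior_subset
  refine ⟨interior {p | (16 : ℕ∞) ≤ numRealSols p}, isOpen_interior,
    ⟨_, mem_interior_iff_mem_nhds.2 hev⟩, fun _ hp => hsub hp, ?_⟩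
  have hcurve : Continuous fun s : ℝ => ((-1, 15 / 77, 70 / 143, 5 / 26, 35 / 81, 0, s, s, s) :
      ℝ × ℝ × ℝ × ℝ × ℝ × ℝ × ℝ × ℝ × ℝ) := by
    fun_prop
  have hnear := (hcurve.tendsto 0).eventually (eventually_eventually_nhds.2 hev)
  obtain ⟨s, hs, hpos⟩ :=
    ((hnear.filter_mono nhdsWithin_le_nhds).and (self_mem_nhdsWithin (s := Set.Ioi (0 : ℝ)))).exists
  have hne : s ≠ 0 := ne_of_gt hpos
  exact ⟨_, mem_interior_iff_mem_nhds.2 hs, hne, hne, hne⟩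
end

section
/- The univariate sextic polynomial r6(x) = x⁶ + 13.4913 x⁵ + 136.2685 x⁴ − 144.4123 x³ + 18.9004 x² − 0.5871 x + 0.0017 (with the displayed exact rational coefficients) has exactly 4 distinct positive real roots. -/
/-- A polynomial of degree six with leading coefficients `1, p, q` where `p, q > 0` does not have
five distinct positive roots: the fourth divided difference would vanish at them. -/
theorem not_five_positive_roots {p q r s t u : ℝ} (hp : 0 < p) (hq : 0 < q)
    {f : ℝ → ℝ}
    (hf : ∀ x, f x = x ^ 6 + p * x ^ 5 + q * x ^ 4 + r * x ^ 3 + s * x ^ 2 + t * x + u)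
    {a b c d e : ℝ} (ha : 0 < a) (hb : 0 < b) (hc : 0 < c) (hd : 0 < d) (he : 0 < e)
    (fa : f a = 0) (fb : f b = 0) (fc : f c = 0) (fd : f d = 0) (fe : f e = 0)
    (hab : a < b) (hbc : b < c) (hcd : c < d) :
    e = a ∨ e = b ∨ e = c ∨ e = d := by
  rw [hf] at fa fb fc fd fe
  have key : (b - a) * (c - a) * (d - a) * (c - b) * (d - b) * (d - c) *
      ((e - a) * (e - b) * (e - c) * (e - d)) *
      (a ^ 2 + b ^ 2 + c ^ 2 + d ^ 2 + e ^ 2 + a * b + a * c + a * d + a * e + b * c + b * d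
        + b * e + c * d + c * e + d * e + p * (a + b + c + d + e) + q) = 0 := by
    linear_combination
      (c - b) * (d - b) * (e - b) * (d - c) * (e - c) * (e - d) * fa
      - (c - a) * (d - a) * (e - a) * (d - c) * (e - c) * (e - d) * fb
      + (b - a) * (d - a) * (e - a) * (d - b) * (e - b) * (e - d) * fc
      - (b - a) * (c - a) * (e - a) * (c - b) * (e - b) * (e - c) * fd
      + (b - a) * (c - a) * (d - a) * (c - b) * (d - b) * (d - c) * fe
  have hV : 0 < (b - a) * (c - a) * (d - a) * (c - b) * (d - b) * (d - c) := by
    have h₁ := sub_pos.2 hab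
    have h₂ := sub_pos.2 (hab.trans hbc)
    have h₃ := sub_pos.2 (hab.trans (hbc.trans hcd))
    have h₄ := sub_pos.2 hbc
    have h₅ := sub_pos.2 (hbc.trans hcd)
    have h₆ := sub_pos.2 hcd
    positivity
  have hE := (mul_eq_zero.1 key).resolve_right (by positivity)
  simpa [sub_eq_zero, or_assoc] using (mul_eq_zero.1 hE).resolve_left hV.ne'

/-- A continuous function whose values at two points have opposite signs has a zero strictly
between them. -/
theorem exists_zero_of_mul_neg {f : ℝ → ℝ} (hf : Continuous f) {a b : ℝ} (hab : a < b)
    (h : f a * f b < 0) : ∃ x, a < x ∧ x < b ∧ f x = 0 := by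
  rcases mul_neg_iff.1 h with ⟨ha, hb⟩ | ⟨ha, hb⟩
  · obtain ⟨x, hx, h0⟩ := intermediate_value_Ioo' hab.le hf.continuousOn ⟨hb, ha⟩
    exact ⟨x, hx.1, hx.2, h0⟩
  · obtain ⟨x, hx, h0⟩ := intermediate_value_Ioo hab.le hf.continuousOn ⟨ha, hb⟩
    exact ⟨x, hx.1, hx.2, h0⟩

/-- The sextic `r6(x) = x⁶ + 13.4913 x⁵ + 136.2685 x⁴ − 144.4123 x³ + 18.9004 x²
− 0.5871 x + 0.0017` (exact rational coefficients) has exactly 4 distinct positive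
real roots. -/
theorem stmt10 :
    {x : ℝ | 0 < x ∧
      x ^ 6 + (134913 / 10000) * x ^ 5 + (1362685 / 10000) * x ^ 4
        - (1444123 / 10000) * x ^ 3 + (189004 / 10000) * x ^ 2
        - (5871 / 10000) * x + 17 / 10000 = 0}.encard = 4 := by
  set f : ℝ → ℝ := fun x => x ^ 6 + (134913 / 10000) * x ^ 5 + (1362685 / 10000) * x ^ 4
    - (1444123 / 10000) * x ^ 3 + (189004 / 10000) * x ^ 2 - (5871 / 10000) * x + 17 / 10000
    with hf
  have hcont : Continuous f := by fun_prop
  obtain ⟨a, ha, ha', fa⟩ := exists_zero_of_mul_neg hcont (a := 0) (b := 1 / 100)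
    (by norm_num) (by norm_num [hf])
  obtain ⟨b, hb, hb', fb⟩ := exists_zero_of_mul_neg hcont (a := 1 / 100) (b := 1 / 20)
    (by norm_num) (by norm_num [hf])
  obtain ⟨c, hc, hc', fc⟩ := exists_zero_of_mul_neg hcont (a := 1 / 20) (b := 1 / 2)
    (by norm_num) (by norm_num [hf])
  obtain ⟨d, hd, hd', fd⟩ := exists_zero_of_mul_neg hcont (a := 1 / 2) (b := 1)
    (by norm_num) (by norm_num [hf])
  have hab : a < b := ha'.trans hb
  have hbc : b < c := hb'.trans hc
  have hcd : c < d := hc'.trans hd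
  have hb0 := ha.trans hab
  have hc0 := hb0.trans hbc
  have hd0 := hc0.trans hcd
  have hset : {x : ℝ | 0 < x ∧ f x = 0} = {a, b, c, d} := by
    ext x
    simp only [Set.mem_ofPred_eq, Set.mem_insert_iff, Set.mem_singleton_iff]
    constructor
    · rintro ⟨hx, fx⟩
      exact not_five_positive_roots (p := 134913 / 10000) (q := 1362685 / 10000)
        (r := -(1444123 / 10000)) (s := 189004 / 10000) (t := -(5871 / 10000)) (u := 17 / 10000)
        (by norm_num) (by norm_num) (fun y => by simp only [hf]; ring)
        ha hb0 hc0 hd0 hx fa fb fc fd fx hab hbc hcd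
    · rintro (rfl | rfl | rfl | rfl)
      exacts [⟨ha, fa⟩, ⟨hb0, fb⟩, ⟨hc0, fc⟩, ⟨hd0, fd⟩]
  change {x : ℝ | 0 < x ∧ f x = 0}.encard = 4
  have hbd := hbc.trans hcd
  rw [hset, Set.encard_insert_of_notMem (by simp [hab.ne, (hab.trans hbc).ne, (hab.trans hbd).ne]),
    Set.encard_insert_of_notMem (by simp [hbc.ne, hbd.ne]),
    Set.encard_insert_of_notMem (by simp [hcd.ne]), Set.encard_singleton]
  norm_num
end

section
/- There exist susceptance parameters b12, b13, b14, b23, b24, b34 ∈ ℝ with b12 = 0 such that the lossless four-bus power flow system with unity voltage magnitudes and zero active power injections (P2 = P3 = P4 = 0) has at least 16 distinct real solutions. (For such systems the number of complex solutions is at most 16, so all complex solutions can be real when one line is absent.) -/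
/-- The eight solutions with all voltage angles in `{0, π}`, with arbitrary susceptances. -/
theorem PFSolT.of_real {b12 b13 b14 b23 b24 b34 s t u : ℝ}
    (hs : s ^ 2 = 1) (ht : t ^ 2 = 1) (hu : u ^ 2 = 1) :
    PFSolT b12 b13 b14 b23 b24 b34 0 0 0 (s, 0, t, 0, u, 0) := by
  simp [PFSolT, hs, ht, hu]

/-- With `b13 = b14 = b23 = 1` and `b24 = -1`, the points of the unit circle on the curve
`x + y + 2 * b34 * x * y = 0` give solutions whose second voltage is `± i`. -/
theorem PFSolT.of_circle {b e x y : ℝ} (he : e ^ 2 = 1) (hxy : x ^ 2 + y ^ 2 = 1)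
    (h : x + y + 2 * b * x * y = 0) :
    PFSolT 0 1 1 1 (-1) b 0 0 0 (0, e, x, -(e * y), x, e * y) := by
  refine ⟨by ring, ?_, ?_, by linear_combination he, ?_, ?_⟩
  · linear_combination (-e) * h
  · linear_combination e * h
  · linear_combination hxy + y ^ 2 * he
  · linear_combination hxy + y ^ 2 * he

/-- Four distinct points of the unit circle on the curve give sixteen solutions. -/
theorem sixteen_le_encard_of_circle {b : ℝ} (S : Finset (ℝ × ℝ)) (hS : S.card = 4)
    (h : ∀ z ∈ S, z.1 ^ 2 + z.2 ^ 2 = 1 ∧ z.1 + z.2 + 2 * b * z.1 * z.2 = 0) :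
    16 ≤ {v : ℝ × ℝ × ℝ × ℝ × ℝ × ℝ | PFSolT 0 1 1 1 (-1) b 0 0 0 v}.encard := by
  classical
  let E : Finset ℝ := {1, -1}
  have hE : E.card = 2 := Finset.card_pair (by norm_num)
  have hsq : ∀ e ∈ E, e ^ 2 = 1 := by simp [E]
  let f : ℝ × ℝ × ℝ → ℝ × ℝ × ℝ × ℝ × ℝ × ℝ := fun z => (z.1, 0, z.2.1, 0, z.2.2, 0)
  let g : ℝ × ℝ × ℝ → ℝ × ℝ × ℝ × ℝ × ℝ × ℝ :=
    fun z => (0, z.1, z.2.1, -(z.1 * z.2.2), z.2.1, z.1 * z.2.2)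
  let T := (E ×ˢ E ×ˢ E).image f
  let N := (E ×ˢ S).image g
  have hT : T.card = 8 := by
    rw [Finset.card_image_of_injective, Finset.card_product, Finset.card_product, hE]
    rintro ⟨s, t, u⟩ ⟨s', t', u'⟩ h
    simpa [f] using h
  have hN : N.card = 8 := by
    rw [Finset.card_image_of_injOn, Finset.card_product, hE, hS]
    rintro ⟨e, x, y⟩ h₁ ⟨e', x', y'⟩ - h
    have he : e ≠ 0 := by
      have := hsq e (by simp_all)
      rintro rfl
      norm_num at this
    simp only [g, Prod.mk.injEq] at h
    obtain ⟨-, rfl, rfl, -, -, h⟩ := h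
    simp [mul_left_cancel₀ he h]
  have hd : Disjoint T N := by
    rw [Finset.disjoint_left]
    intro v hv hv'
    obtain ⟨z, hz, rfl⟩ := Finset.mem_image.1 hv
    obtain ⟨w, -, hw⟩ := Finset.mem_image.1 hv'
    have hz1 := hsq z.1 (Finset.mem_product.1 hz).1
    rw [← show (0 : ℝ) = z.1 from congrArg Prod.fst hw] at hz1
    norm_num at hz1
  have hc : (T ∪ N).card = 16 := by rw [Finset.card_union_of_disjoint hd, hT, hN]
  have hsub : (↑(T ∪ N) : Set (ℝ × ℝ × ℝ × ℝ × ℝ × ℝ)) ⊆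
      {v | PFSolT 0 1 1 1 (-1) b 0 0 0 v} := by
    intro v hv
    rcases Finset.mem_union.1 (Finset.mem_coe.1 hv) with hv | hv
    · obtain ⟨z, hz, rfl⟩ := Finset.mem_image.1 hv
      simp only [Finset.mem_product] at hz
      exact PFSolT.of_real (hsq _ hz.1) (hsq _ hz.2.1) (hsq _ hz.2.2)
    · obtain ⟨z, hz, rfl⟩ := Finset.mem_image.1 hv
      simp only [Finset.mem_product] at hz
      exact PFSolT.of_circle (hsq _ hz.1) (h _ hz.2).1 (h _ hz.2).2
  have := Set.encard_le_encard hsub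
  rw [Set.encard_coe_eq_coe_finsetCard, hc] at this
  exact_mod_cast this

/-- There exist susceptance parameters with `b12 = 0` (no line between buses 1 and 2)
for which the four-bus system with unity magnitudes and zero injections has at least
16 distinct real solutions. -/
theorem stmt13 : ∃ b13 b14 b23 b24 b34 : ℝ,
    16 ≤ {v : ℝ × ℝ × ℝ × ℝ × ℝ × ℝ |
      PFSolT 0 b13 b14 b23 b24 b34 0 0 0 v}.encard := by
  classical
  obtain ⟨p, hp0, hp⟩ : ∃ p : ℝ, 0 < p ∧ p ^ 2 = 7 := ⟨√7, by positivity, by norm_num⟩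
  obtain ⟨r, hr0, hr⟩ : ∃ r : ℝ, 0 < r ∧ r ^ 2 = 34 := ⟨√34, by positivity, by norm_num⟩
  have hp3 : p < 3 := by nlinarith
  have hr5 : 5 < r := by nlinarith
  have hr6 : r < 5.9 := by nlinarith
  refine ⟨1, 1, 1, -1, -20 / 9, sixteen_le_encard_of_circle
    {((5 + p) / 8, (5 - p) / 8), ((5 - p) / 8, (5 + p) / 8),
      ((-4 + r) / 10, (-4 - r) / 10), ((-4 - r) / 10, (-4 + r) / 10)} ?_ ?_⟩
  · have hp27 : p < 2.7 := by nlinarith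
    have h₁ : (5 + p) / 8 ≠ (5 - p) / 8 := by intro h; linarith
    have h₂ : (5 + p) / 8 ≠ (-4 + r) / 10 := by intro h; linarith
    have h₃ : (5 + p) / 8 ≠ (-4 - r) / 10 := by intro h; linarith
    have h₄ : (5 - p) / 8 ≠ (-4 + r) / 10 := by intro h; linarith
    have h₅ : (5 - p) / 8 ≠ (-4 - r) / 10 := by intro h; linarith
    have h₆ : (-4 + r) / 10 ≠ (-4 - r) / 10 := by intro h; linarith
    repeat rw [Finset.card_insert_of_notMem (by
      simp only [Finset.mem_insert, Finset.mem_singleton, Prod.mk.injEq]; tauto)]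
    simp
  · simp only [Finset.mem_insert, Finset.mem_singleton]
    rintro z (rfl | rfl | rfl | rfl) <;> constructor <;> nlinarith
end

section
/- Let b12 = 0 and let b13, b14, b23, b24, b34 ∈ ℝ be arbitrary, and take zero active power injections (P2 = P3 = P4 = 0). If the set of complex solutions of the lossless four-bus power flow system with unity voltage magnitudes is finite, then the system has at most 16 real solutions. -/
/-- The lossless four-bus power flow system with unity voltage magnitudes, over an
arbitrary commutative ring (used for both real and complex solutions):
slack bus `V_{d1} = 1, V_{q1} = 0`, variables `V_{di}, V_{qi}` for `i = 2,3,4`,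
line susceptances `b_{ik}` and active power injections `P_i`. -/
def PFSysT {K : Type*} [CommRing K] (b12 b13 b14 b23 b24 b34 P2 P3 P4 : K)
    (v : K × K × K × K × K × K) : Prop :=
  match v with
  | (vd2, vq2, vd3, vq3, vd4, vq4) =>
    b23 * (vd3 * vq2 - vd2 * vq3) + b24 * (vd4 * vq2 - vd2 * vq4) + b12 * vq2 = P2 ∧
    b23 * (vd2 * vq3 - vd3 * vq2) + b34 * (vd4 * vq3 - vd3 * vq4) + b13 * vq3 = P3 ∧
    b24 * (vd2 * vq4 - vd4 * vq2) + b34 * (vd3 * vq4 - vd4 * vq3) + b14 * vq4 = P4 ∧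
    vd2 ^ 2 + vq2 ^ 2 = 1 ∧ vd3 ^ 2 + vq3 ^ 2 = 1 ∧ vd4 ^ 2 + vq4 ^ 2 = 1

/-- The complex unit circle `c ^ 2 + s ^ 2 = 1` is parametrised by its second coordinate. -/
theorem exists_circle_section : ∃ c : ℂ → ℂ, ∀ s, c s ^ 2 + s ^ 2 = 1 := by
  have h : ∀ s : ℂ, ∃ c : ℂ, c ^ 2 + s ^ 2 = 1 := fun s => by
    obtain ⟨c, hc⟩ := IsAlgClosed.exists_pow_nat_eq (1 - s ^ 2) (n := 2) (by norm_num)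
    exact ⟨c, by rw [hc]; ring⟩
  exact Classical.skolem.mp h

section Complex

variable {b13 b14 b23 b24 b34 : ℂ}

theorem PFSysT.not_finite_of_family {b12 P2 P3 P4 : ℂ}
    (F : ℂ → ℂ × ℂ × ℂ × ℂ × ℂ × ℂ) (g : ℂ × ℂ × ℂ × ℂ × ℂ × ℂ → ℂ)
    (hg : ∀ t, g (F t) = t) (hF : ∀ t, PFSysT b12 b13 b14 b23 b24 b34 P2 P3 P4 (F t)) :
    ¬ {v | PFSysT b12 b13 b14 b23 b24 b34 P2 P3 P4 v}.Finite :=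
  Set.infinite_of_injective_forall_mem (Function.LeftInverse.injective hg) hF

theorem PFSysT.bus_two_connected
    (hfin : {v | PFSysT (0 : ℂ) b13 b14 b23 b24 b34 0 0 0 v}.Finite) :
    ¬ (b23 = 0 ∧ b24 = 0) := by
  rintro ⟨rfl, rfl⟩
  obtain ⟨c, hc⟩ := exists_circle_section
  exact not_finite_of_family (fun t => (c t, t, 1, 0, 1, 0)) (fun v => v.2.1)
    (fun _ => rfl) (fun t => by simp [PFSysT, hc]) hfin

theorem PFSysT.slack_connected
    (hfin : {v | PFSysT (0 : ℂ) b13 b14 b23 b24 b34 0 0 0 v}.Finite) :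
    ¬ (b13 = 0 ∧ b14 = 0) := by
  rintro ⟨rfl, rfl⟩
  obtain ⟨c, hc⟩ := exists_circle_section
  exact not_finite_of_family (fun t => (c t, t, c t, t, c t, t)) (fun v => v.2.1)
    (fun _ => rfl) (fun t => by simp [PFSysT, hc]) hfin

theorem PFSysT.bridge_ne_zero
    (hfin : {v | PFSysT (0 : ℂ) b13 b14 b23 b24 b34 0 0 0 v}.Finite)
    (hα : b13 * b14 = 0) (hβ : b23 * b24 = 0) : b34 ≠ 0 := by
  rintro rfl
  obtain ⟨c, hc⟩ := exists_circle_section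
  rcases mul_eq_zero.mp hα with rfl | rfl <;> rcases mul_eq_zero.mp hβ with rfl | rfl
  · exact not_finite_of_family (fun t => (1, 0, c t, t, 1, 0)) (fun v => v.2.2.2.1)
      (fun _ => rfl) (fun t => by simp [PFSysT, hc]) hfin
  · exact not_finite_of_family (fun t => (c t, t, c t, t, 1, 0)) (fun v => v.2.1)
      (fun _ => rfl) (fun t => by simp [PFSysT, hc]) hfin
  · exact not_finite_of_family (fun t => (c t, t, 1, 0, c t, t)) (fun v => v.2.1)
      (fun _ => rfl) (fun t => by simp [PFSysT, hc]) hfin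
  · exact not_finite_of_family (fun t => (1, 0, 1, 0, c t, t)) (fun v => v.2.2.2.2.2)
      (fun _ => rfl) (fun t => by simp [PFSysT, hc]) hfin

theorem PFSysT.not_balanced_of_parallel {ε : ℂ} (hε : ε ^ 2 = 1) (h14 : b14 ≠ 0)
    (h23 : b23 = ε * b13) (h24 : b24 = ε * b14) :
    ¬ {v | PFSysT (0 : ℂ) b13 b14 b23 b24 0 0 0 0 v}.Finite := by
  obtain ⟨c, hc⟩ := exists_circle_section
  refine not_finite_of_family
    (fun t => (-ε, 0, c t, t, c (-b13 * t / b14), -b13 * t / b14)) (fun v => v.2.2.2.1)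
    (fun _ => rfl) (fun t => ?_)
  have h4 : b14 * (-b13 * t / b14) = -b13 * t := mul_div_cancel₀ _ h14
  have hc4 := hc (-b13 * t / b14)
  generalize -b13 * t / b14 = s at *
  subst h23 h24
  refine ⟨?_, ?_, ?_, ?_, hc t, hc4⟩
  · linear_combination ε ^ 2 * h4
  · linear_combination (-b13 * t) * hε
  · linear_combination (-b14 * s) * hε
  · linear_combination hε

theorem PFSysT.not_balanced_of_crossed {ε : ℂ} (hε : ε ^ 2 = 1) (h14 : b14 ≠ 0)
    (h23 : b23 = ε * b14) (h24 : b24 = ε * b13) :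
    ¬ {v | PFSysT (0 : ℂ) b13 b14 b23 b24 0 0 0 0 v}.Finite := by
  obtain ⟨c, hc⟩ := exists_circle_section
  refine not_finite_of_family
    (fun t => (-ε * (c t * c (-b13 * t / b14) - t * (-b13 * t / b14)),
      -ε * (c t * (-b13 * t / b14) + t * c (-b13 * t / b14)),
      c t, t, c (-b13 * t / b14), -b13 * t / b14)) (fun v => v.2.2.2.1)
    (fun _ => rfl) (fun t => ?_)
  have h4 : b14 * (-b13 * t / b14) = -b13 * t := mul_div_cancel₀ _ h14
  have hc4 := hc (-b13 * t / b14)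
  have hc3 := hc t
  generalize -b13 * t / b14 = s at *
  generalize c s = d at *
  generalize c t = e at *
  subst h23 h24
  refine ⟨?_, ?_, ?_, ?_, hc3, hc4⟩
  · linear_combination (-ε ^ 2) * h4 - ε ^ 2 * b14 * s * hc3 - ε ^ 2 * b13 * t * hc4
  · linear_combination h4 + b14 * s * hε + ε ^ 2 * b14 * s * hc3
  · linear_combination h4 + b13 * t * hε + ε ^ 2 * b13 * t * hc4
  · linear_combination hε + ε ^ 2 * (d ^ 2 + s ^ 2) * hc3 + ε ^ 2 * hc4

theorem PFSysT.not_balanced (hα : b13 * b14 ≠ 0) (hαβ : b13 * b14 = b23 * b24)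
    (hpq : b23 ^ 2 + b24 ^ 2 = b13 ^ 2 + b14 ^ 2) :
    ¬ {v | PFSysT (0 : ℂ) b13 b14 b23 b24 0 0 0 0 v}.Finite := by
  obtain ⟨h13, h14⟩ := mul_ne_zero_iff.mp hα
  have h : (b23 ^ 2 - b13 ^ 2) * (b24 ^ 2 - b13 ^ 2) = 0 := by
    linear_combination (-b13 ^ 2) * hpq - (b13 * b14 + b23 * b24) * hαβ
  have key : ∀ x y : ℂ, x * y = b13 * b14 → x ^ 2 - b13 ^ 2 = 0 →
      ∃ ε : ℂ, ε ^ 2 = 1 ∧ x = ε * b13 ∧ y = ε * b14 := by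
    intro x y hxy hx
    have hx2 : x ^ 2 = b13 ^ 2 := sub_eq_zero.mp hx
    refine ⟨x / b13, by rw [div_pow, hx2, div_self (pow_ne_zero 2 h13)], by field_simp, ?_⟩
    have hx0 : x ≠ 0 := by rintro rfl; simp [h13, h14] at hxy
    rw [div_mul_eq_mul_div, eq_div_iff h13]
    apply mul_left_cancel₀ hx0
    linear_combination b13 * hxy - b14 * hx2
  rcases mul_eq_zero.mp h with h | h
  · obtain ⟨ε, hε, h1, h2⟩ := key b23 b24 hαβ.symm h
    exact not_balanced_of_parallel hε h14 h1 h2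
  · obtain ⟨ε, hε, h1, h2⟩ := key b24 b23 (by rw [hαβ, mul_comm]) h
    exact not_balanced_of_crossed hε h14 h2 h1

theorem PFSysT.not_both_degenerate {σ : ℂ}
    (hfin : {v | PFSysT (0 : ℂ) b13 b14 b23 b24 b34 0 0 0 v}.Finite) (hσ : σ ^ 2 = 1)
    (hU : b13 * σ + b14 = 0) : b23 * σ + b24 ≠ 0 := by
  intro hW
  have h23 : b23 ≠ 0 := by
    rintro rfl
    exact bus_two_connected hfin ⟨rfl, by simpa using hW⟩
  obtain ⟨c, hc⟩ := exists_circle_section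
  obtain rfl : b14 = -b13 * σ := by linear_combination hU
  obtain rfl : b24 = -b23 * σ := by linear_combination hW
  refine not_finite_of_family
    (fun t => (c t * c (-b13 * t / b23) + t * (-b13 * t / b23),
      t * c (-b13 * t / b23) - c t * (-b13 * t / b23),
      c t, t, σ * c t, σ * t)) (fun v => v.2.2.2.1) (fun _ => rfl) (fun t => ?_) hfin
  have h4 : b23 * (-b13 * t / b23) = -b13 * t := mul_div_cancel₀ _ h23
  have hc4 := hc (-b13 * t / b23)
  have hc3 := hc t
  generalize -b13 * t / b23 = s at *
  generalize c s = d at *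
  generalize c t = e at *
  refine ⟨?_, ?_, ?_, ?_, hc3, ?_⟩
  · linear_combination b23 * s * (e ^ 2 + t ^ 2) * hσ
  · linear_combination h4 + b23 * s * hc3
  · linear_combination (-σ ^ 2) * h4 - σ ^ 2 * b23 * s * hc3
  · linear_combination hc4 + (d ^ 2 + s ^ 2) * hc3
  · linear_combination hσ + σ ^ 2 * hc3

end Complex

section Real

variable {b13 b14 b23 b24 b34 : ℝ}

/-- The real part of `e₃ * conj e₄`, where `eᵢ` is the voltage phasor of bus `i`. -/
def phaseCos (v : ℝ × ℝ × ℝ × ℝ × ℝ × ℝ) : ℝ :=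
  v.2.2.1 * v.2.2.2.2.1 + v.2.2.2.1 * v.2.2.2.2.2

/-- The imaginary part of `e₃ * conj e₄`, where `eᵢ` is the voltage phasor of bus `i`. -/
def phaseSin (v : ℝ × ℝ × ℝ × ℝ × ℝ × ℝ) : ℝ :=
  v.2.2.2.1 * v.2.2.2.2.1 - v.2.2.1 * v.2.2.2.2.2

/-- The real part of `(b₁₃ e₃ + b₁₄ e₄) * conj e₁`. -/
def slackField (b13 b14 : ℝ) (v : ℝ × ℝ × ℝ × ℝ × ℝ × ℝ) : ℝ :=
  b13 * v.2.2.1 + b14 * v.2.2.2.2.1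

/-- The real part of `(b₂₃ e₃ + b₂₄ e₄) * conj e₂`. -/
def busTwoField (b23 b24 : ℝ) (v : ℝ × ℝ × ℝ × ℝ × ℝ × ℝ) : ℝ :=
  b23 * (v.2.2.1 * v.1 + v.2.2.2.1 * v.2.1) +
    b24 * (v.2.2.2.2.1 * v.1 + v.2.2.2.2.2 * v.2.1)

/-- The solutions whose three phasors are all `±1`. -/
noncomputable def trivialSolutions : Finset (ℝ × ℝ × ℝ × ℝ × ℝ × ℝ) :=
  (Finset.univ : Finset (Bool × Bool × Bool)).image fun s =>
    (cond s.1 1 (-1), 0, cond s.2.1 1 (-1), 0, cond s.2.2 1 (-1), 0)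

theorem card_trivialSolutions_le : trivialSolutions.card ≤ 8 :=
  Finset.card_image_le

theorem mem_trivialSolutions {x2 x3 x4 : ℝ} (h2 : x2 ^ 2 = 1) (h3 : x3 ^ 2 = 1)
    (h4 : x4 ^ 2 = 1) : (x2, 0, x3, 0, x4, 0) ∈ trivialSolutions := by
  have key : ∀ x : ℝ, x ^ 2 = 1 → ∃ s : Bool, cond s 1 (-1) = x := fun x hx => by
    rcases sq_eq_one_iff.mp hx with rfl | rfl
    exacts [⟨true, rfl⟩, ⟨false, rfl⟩]
  obtain ⟨s2, rfl⟩ := key x2 h2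
  obtain ⟨s3, rfl⟩ := key x3 h3
  obtain ⟨s4, rfl⟩ := key x4 h4
  exact Finset.mem_image.mpr ⟨(s2, s3, s4), Finset.mem_univ _, rfl⟩

theorem eq_of_sq_eq_sq_of_pos_iff {a b : ℝ} (ha : a ≠ 0) (h : a ^ 2 = b ^ 2)
    (hab : 0 < a ↔ 0 < b) : a = b := by
  rcases sq_eq_sq_iff_eq_or_eq_neg.mp h with h | rfl
  · exact h
  · have hb : b ≠ 0 := fun hb => ha (by simp [hb])
    rcases lt_or_gt_of_ne hb with hb | hb
    · linarith [hab.mp (by linarith)]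
    · linarith [hab.mpr hb]

namespace PFSysT

variable {v w : ℝ × ℝ × ℝ × ℝ × ℝ × ℝ}

theorem phaseCos_sq_add (hv : PFSysT 0 b13 b14 b23 b24 b34 0 0 0 v) :
    phaseCos v ^ 2 + phaseSin v ^ 2 = 1 := by
  obtain ⟨x2, y2, x3, y3, x4, y4⟩ := v
  obtain ⟨-, -, -, -, h3, h4⟩ := hv
  simp only [phaseCos, phaseSin]
  linear_combination (x4 ^ 2 + y4 ^ 2) * h3 + h4

theorem slack_balance (hv : PFSysT 0 b13 b14 b23 b24 b34 0 0 0 v) :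
    b13 * v.2.2.2.1 + b14 * v.2.2.2.2.2 = 0 := by
  obtain ⟨x2, y2, x3, y3, x4, y4⟩ := v
  obtain ⟨e2, e3, e4, -, -, -⟩ := hv
  linear_combination e2 + e3 + e4

theorem slackField_sq (hv : PFSysT 0 b13 b14 b23 b24 b34 0 0 0 v) :
    slackField b13 b14 v ^ 2 = b13 ^ 2 + b14 ^ 2 + 2 * (b13 * b14) * phaseCos v := by
  have h1 := hv.slack_balance
  obtain ⟨x2, y2, x3, y3, x4, y4⟩ := v
  obtain ⟨-, -, -, -, h3, h4⟩ := hv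
  simp only [slackField, phaseCos] at *
  linear_combination b13 ^ 2 * h3 + b14 ^ 2 * h4 - (b13 * y3 + b14 * y4) * h1

theorem busTwoField_sq (hv : PFSysT 0 b13 b14 b23 b24 b34 0 0 0 v) :
    busTwoField b23 b24 v ^ 2 = b23 ^ 2 + b24 ^ 2 + 2 * (b23 * b24) * phaseCos v := by
  obtain ⟨x2, y2, x3, y3, x4, y4⟩ := v
  obtain ⟨e2, -, -, h2, h3, h4⟩ := hv
  simp only [busTwoField, phaseCos]
  linear_combination b23 ^ 2 * h3 + b24 ^ 2 * h4
    + ((b23 * x3 + b24 * x4) ^ 2 + (b23 * y3 + b24 * y4) ^ 2) * h2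
    - (b23 * (x3 * y2 - x2 * y3) + b24 * (x4 * y2 - x2 * y4)) * e2

theorem slackField_ne_zero (hv : PFSysT 0 b13 b14 b23 b24 b34 0 0 0 v)
    (hs : ¬ (b13 = 0 ∧ b14 = 0)) (hS : phaseSin v ≠ 0) : slackField b13 b14 v ≠ 0 := by
  intro hT
  have h1 := hv.slack_balance
  obtain ⟨x2, y2, x3, y3, x4, y4⟩ := v
  simp only [slackField, phaseSin] at *
  refine hs ⟨mul_right_cancel₀ hS ?_, mul_right_cancel₀ hS ?_⟩
  · linear_combination x4 * h1 - y4 * hT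
  · linear_combination y3 * hT - x3 * h1

theorem busTwoField_ne_zero (hv : PFSysT 0 b13 b14 b23 b24 b34 0 0 0 v)
    (hs : ¬ (b23 = 0 ∧ b24 = 0)) (hS : phaseSin v ≠ 0) : busTwoField b23 b24 v ≠ 0 := by
  intro hR
  obtain ⟨x2, y2, x3, y3, x4, y4⟩ := v
  obtain ⟨e2, -, -, h2, -, -⟩ := hv
  simp only [busTwoField, phaseSin] at *
  have hx : b23 * x3 + b24 * x4 = 0 := by
    linear_combination x2 * hR + y2 * e2 - (b23 * x3 + b24 * x4) * h2
  have hy : b23 * y3 + b24 * y4 = 0 := by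
    linear_combination y2 * hR - x2 * e2 - (b23 * y3 + b24 * y4) * h2
  refine hs ⟨mul_right_cancel₀ hS ?_, mul_right_cancel₀ hS ?_⟩
  · linear_combination x4 * hy - y4 * hx
  · linear_combination y3 * hx - x3 * hy

theorem field_relation (hv : PFSysT 0 b13 b14 b23 b24 b34 0 0 0 v) (hS : phaseSin v ≠ 0) :
    b23 * b24 * slackField b13 b14 v +
      b34 * busTwoField b23 b24 v * slackField b13 b14 v +
      b13 * b14 * busTwoField b23 b24 v = 0 := by
  have h1 := hv.slack_balance
  apply mul_left_cancel₀ hS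
  obtain ⟨x2, y2, x3, y3, x4, y4⟩ := v
  obtain ⟨e2, e3, -, h2, -, -⟩ := hv
  simp only [slackField, phaseSin] at *
  have hU : y3 * (b13 * x3 + b14 * x4) = b14 * (y3 * x4 - x3 * y4) := by
    linear_combination x3 * h1
  have hW : (x2 * y3 - x3 * y2) * busTwoField b23 b24 (x2, y2, x3, y3, x4, y4) =
      b24 * (y3 * x4 - x3 * y4) := by
    simp only [busTwoField]
    linear_combination (-(x3 * x2 + y3 * y2)) * e2 + b24 * (y3 * x4 - x3 * y4) * h2
  generalize busTwoField b23 b24 (x2, y2, x3, y3, x4, y4) = R at *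
  linear_combination R * (b13 * x3 + b14 * x4) * e3 - b23 * (b13 * x3 + b14 * x4) * hW
    - b13 * R * hU

theorem eq_of_invariants (hv : PFSysT 0 b13 b14 b23 b24 b34 0 0 0 v)
    (hw : PFSysT 0 b13 b14 b23 b24 b34 0 0 0 w)
    (h1 : ¬ (b13 = 0 ∧ b14 = 0)) (h2 : ¬ (b23 = 0 ∧ b24 = 0)) (hS : phaseSin v ≠ 0)
    (hSS : phaseSin v = phaseSin w) (hCC : phaseCos v = phaseCos w)
    (hTT : slackField b13 b14 v = slackField b13 b14 w)
    (hRR : busTwoField b23 b24 v = busTwoField b23 b24 w) : v = w := by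
  have hT := hv.slackField_ne_zero h1 hS
  have hR := hv.busTwoField_ne_zero h2 hS
  have hbv := hv.slack_balance
  have hbw := hw.slack_balance
  obtain ⟨x2, y2, x3, y3, x4, y4⟩ := v
  obtain ⟨u2, z2, u3, z3, u4, z4⟩ := w
  obtain ⟨e2, -, -, n2, n3, n4⟩ := hv
  obtain ⟨e2', -, -, m2, m3, m4⟩ := hw
  simp only [slackField, phaseSin, phaseCos] at *
  have hy3 : y3 = z3 := mul_right_cancel₀ hT (by
    linear_combination x3 * hbv - u3 * hbw + b14 * hSS - z3 * hTT)
  have hy4 : y4 = z4 := mul_right_cancel₀ hT (by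
    linear_combination x4 * hbv - u4 * hbw - b13 * hSS - z4 * hTT)
  have hx3 : x3 = u3 := mul_right_cancel₀ hT (by
    linear_combination b13 * n3 - b13 * m3 + b14 * hCC - y3 * hbv + z3 * hbw - u3 * hTT)
  have hx4 : x4 = u4 := mul_right_cancel₀ hT (by
    linear_combination b14 * n4 - b14 * m4 + b13 * hCC - y4 * hbv + z4 * hbw - u4 * hTT)
  subst hy3 hy4 hx3 hx4
  have hx2 : x2 = u2 := mul_right_cancel₀ hR (by
    conv_rhs => rw [hRR]
    simp only [busTwoField]
    linear_combination (b23 * x3 + b24 * x4) * (n2 - m2) - y2 * e2 + z2 * e2')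
  have hy2 : y2 = z2 := mul_right_cancel₀ hR (by
    conv_rhs => rw [hRR]
    simp only [busTwoField]
    linear_combination (b23 * y3 + b24 * y4) * (n2 - m2) + x2 * e2 - u2 * e2')
  rw [hx2, hy2]

theorem mem_trivialSolutions_of_phaseSin_eq_zero
    (hv : PFSysT 0 b13 b14 b23 b24 b34 0 0 0 v)
    (h1 : ¬ (b13 = 0 ∧ b14 = 0)) (h2 : ¬ (b23 = 0 ∧ b24 = 0))
    (hd : ∀ σ : ℝ, σ ^ 2 = 1 → b13 * σ + b14 = 0 → b23 * σ + b24 ≠ 0)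
    (hS : phaseSin v = 0) : v ∈ trivialSolutions := by
  have hC : phaseCos v ^ 2 = 1 := by
    have := hv.phaseCos_sq_add
    rw [hS] at this
    linear_combination this
  have hb := hv.slack_balance
  have hd := hd _ hC
  obtain ⟨x2, y2, x3, y3, x4, y4⟩ := v
  obtain ⟨e2, e3, -, n2, n3, n4⟩ := hv
  have hx3 : x3 = phaseCos (x2, y2, x3, y3, x4, y4) * x4 := by
    simp only [phaseSin, phaseCos] at *
    linear_combination (-x3) * n4 - y4 * hS
  have hy3 : y3 = phaseCos (x2, y2, x3, y3, x4, y4) * y4 := by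
    simp only [phaseSin, phaseCos] at *
    linear_combination (-y3) * n4 + x4 * hS
  clear hS
  generalize phaseCos (x2, y2, x3, y3, x4, y4) = σ at *
  have hσ : σ ≠ 0 := by rintro rfl; norm_num at hC
  subst hx3 hy3
  simp only at hb
  have hy4 : y4 = 0 := by
    by_contra hy
    have hU : b13 * σ + b14 = 0 := mul_right_cancel₀ hy (by linear_combination hb)
    have hW := hd hU
    have hs : x4 * y2 - x2 * y4 = 0 := mul_left_cancel₀ hW (by linear_combination e2)
    have h13 : b13 = 0 := mul_right_cancel₀ (mul_ne_zero hσ hy) (by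
      linear_combination e3 + b23 * σ * hs)
    exact h1 ⟨h13, by simpa [h13] using hU⟩
  subst hy4
  have hx4 : x4 ≠ 0 := by rintro rfl; norm_num at n4
  have hy2 : y2 = 0 := by
    by_contra hy
    have h23 : b23 = 0 := mul_right_cancel₀ (mul_ne_zero (mul_ne_zero hσ hx4) hy) (by
      linear_combination -e3)
    have h24 : b24 = 0 := mul_right_cancel₀ (mul_ne_zero hx4 hy) (by
      linear_combination e2 - σ * x4 * y2 * h23)
    exact h2 ⟨h23, h24⟩
  subst hy2
  rw [mul_zero] at n3 ⊢
  exact mem_trivialSolutions (by linear_combination n2) (by linear_combination n3)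
    (by linear_combination n4)

theorem eq_of_invariants_of_sign (hv : PFSysT 0 b13 b14 b23 b24 b34 0 0 0 v)
    (hw : PFSysT 0 b13 b14 b23 b24 b34 0 0 0 w)
    (h1 : ¬ (b13 = 0 ∧ b14 = 0)) (h2 : ¬ (b23 = 0 ∧ b24 = 0)) (hS : phaseSin v ≠ 0)
    (hSS : 0 < phaseSin v ↔ 0 < phaseSin w) (hCC : phaseCos v = phaseCos w)
    (hTT : slackField b13 b14 v = slackField b13 b14 w)
    (hRR : busTwoField b23 b24 v = busTwoField b23 b24 w) : v = w := by
  refine hv.eq_of_invariants hw h1 h2 hS (eq_of_sq_eq_sq_of_pos_iff hS ?_ hSS) hCC hTT hRR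
  have h3 := hv.phaseCos_sq_add
  have h4 := hw.phaseCos_sq_add
  rw [hCC] at h3
  linear_combination h3 - h4

end PFSysT

open Polynomial in
/-- The polynomial equation of degree at most four satisfied by `busTwoField` on the nontrivial
solutions, where `α = b₁₃ b₁₄`, `β = b₂₃ b₂₄`, `p = b₂₃² + b₂₄²`, `q = b₁₃² + b₁₄²`. -/
noncomputable def fieldPolynomial (α β γ p q : ℝ) : ℝ[X] :=
  C (α * γ ^ 2) * X ^ 4 + C (2 * α * β * γ) * X ^ 3 +
    C (α * β ^ 2 + (β * q - α * p) * γ ^ 2 - β * α ^ 2) * X ^ 2 +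
    C (2 * β * γ * (β * q - α * p)) * X + C (β ^ 2 * (β * q - α * p))

theorem fieldPolynomial_natDegree_le (α β γ p q : ℝ) :
    (fieldPolynomial α β γ p q).natDegree ≤ 4 := by
  unfold fieldPolynomial
  compute_degree

open Polynomial in
theorem coeff_eq_zero_of_quartic_eq_zero {a b c d e : ℝ}
    (h : C a * X ^ 4 + C b * X ^ 3 + C c * X ^ 2 + C d * X + C e = 0) :
    a = 0 ∧ c = 0 ∧ e = 0 := by
  refine ⟨?_, ?_, ?_⟩
  · simpa [coeff_X, coeff_C] using congrArg (fun P => P.coeff 4) h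
  · simpa [coeff_X, coeff_C] using congrArg (fun P => P.coeff 2) h
  · simpa using congrArg (fun P => P.coeff 0) h

theorem fieldPolynomial_ne_zero {α β γ p q : ℝ} (hα : α ≠ 0) (hβ : β ≠ 0)
    (h : γ = 0 → α = β → p ≠ q) : fieldPolynomial α β γ p q ≠ 0 := by
  intro h0
  obtain ⟨c4, c2, c0⟩ := coeff_eq_zero_of_quartic_eq_zero h0
  have hγ : γ = 0 := by simpa [hα] using c4
  have hαβ : α = β := by
    apply mul_left_cancel₀ (mul_ne_zero hα hβ)
    rw [hγ] at c2
    linear_combination -c2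
  refine h hγ hαβ (mul_left_cancel₀ hβ ?_)
  rw [hαβ] at c0
  have := (mul_eq_zero.mp c0).resolve_left (pow_ne_zero 2 hβ)
  linear_combination -this

open Classical in
theorem PFSysT.encard_nontrivial_le
    (h1 : ¬ (b13 = 0 ∧ b14 = 0)) (h2 : ¬ (b23 = 0 ∧ b24 = 0))
    (h3 : b13 * b14 = 0 → b23 * b24 = 0 → b34 ≠ 0)
    (h4 : b13 * b14 ≠ 0 → b34 = 0 → b13 * b14 = b23 * b24 →
      b23 ^ 2 + b24 ^ 2 ≠ b13 ^ 2 + b14 ^ 2) :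
    {v | PFSysT 0 b13 b14 b23 b24 b34 0 0 0 v ∧ phaseSin v ≠ 0}.encard ≤ 8 := by
  by_cases hβ : b23 * b24 = 0
  · -- The slack field is forced, and the square of the field at bus 2 is fixed.
    have hmain : ∀ v, PFSysT 0 b13 b14 b23 b24 b34 0 0 0 v → phaseSin v ≠ 0 →
        b34 * slackField b13 b14 v = -(b13 * b14) := fun v hv hS => by
      have h := hv.field_relation hS
      rw [hβ] at h
      exact mul_right_cancel₀ (hv.busTwoField_ne_zero h2 hS) (by linear_combination h)
    refine (Set.encard_le_encard_of_injOn (t := (Set.univ : Set (Bool × Bool)))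
      (f := fun v => (decide (0 < phaseSin v), decide (0 < busTwoField b23 b24 v)))
      (fun _ _ => Set.mem_univ _) ?_).trans ?_
    · rintro v ⟨hv, hSv⟩ w ⟨hw, hSw⟩ hvw
      simp only [Prod.mk.injEq, decide_eq_decide] at hvw
      have hTv := hv.slackField_ne_zero h1 hSv
      have hmv := hmain v hv hSv
      have hmw := hmain w hw hSw
      have hγ : b34 ≠ 0 := by
        by_cases hα : b13 * b14 = 0
        · exact h3 hα hβ
        · rintro rfl
          exact hα (by linear_combination hmv)
      have hTT : slackField b13 b14 v = slackField b13 b14 w :=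
        mul_left_cancel₀ hγ (hmv.trans hmw.symm)
      have hα : b13 * b14 ≠ 0 := fun hα => by
        rw [hα, neg_zero] at hmv
        exact mul_ne_zero hγ hTv hmv
      have hCC : phaseCos v = phaseCos w := by
        have h5 := hv.slackField_sq
        rw [hTT, hw.slackField_sq] at h5
        apply mul_left_cancel₀ hα
        linear_combination (-1 / 2) * h5
      have hRR : busTwoField b23 b24 v = busTwoField b23 b24 w :=
        eq_of_sq_eq_sq_of_pos_iff (hv.busTwoField_ne_zero h2 hSv)
          (by rw [hv.busTwoField_sq, hw.busTwoField_sq, hCC]) hvw.2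
      exact hv.eq_of_invariants_of_sign hw h1 h2 hSv hvw.1 hCC hTT hRR
    · rw [Set.encard_univ, ENat.card_eq_coe_fintype_card]
      norm_num
  have hCC : ∀ v w, PFSysT 0 b13 b14 b23 b24 b34 0 0 0 v →
      PFSysT 0 b13 b14 b23 b24 b34 0 0 0 w →
      busTwoField b23 b24 v = busTwoField b23 b24 w → phaseCos v = phaseCos w := by
    intro v w hv hw hRR
    have h5 := hv.busTwoField_sq
    rw [hRR, hw.busTwoField_sq] at h5
    apply mul_left_cancel₀ hβ
    linear_combination (-1 / 2) * h5
  by_cases hα : b13 * b14 = 0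
  · have hmain : ∀ v, PFSysT 0 b13 b14 b23 b24 b34 0 0 0 v → phaseSin v ≠ 0 →
        b34 * busTwoField b23 b24 v = -(b23 * b24) := fun v hv hS => by
      have h := hv.field_relation hS
      rw [hα] at h
      exact mul_right_cancel₀ (hv.slackField_ne_zero h1 hS) (by linear_combination h)
    refine (Set.encard_le_encard_of_injOn (t := (Set.univ : Set (Bool × Bool)))
      (f := fun v => (decide (0 < phaseSin v), decide (0 < slackField b13 b14 v)))
      (fun _ _ => Set.mem_univ _) ?_).trans ?_
    · rintro v ⟨hv, hSv⟩ w ⟨hw, hSw⟩ hvw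
      simp only [Prod.mk.injEq, decide_eq_decide] at hvw
      have hmv := hmain v hv hSv
      have hγ : b34 ≠ 0 := by
        rintro rfl
        exact hβ (by linear_combination hmv)
      have hRR : busTwoField b23 b24 v = busTwoField b23 b24 w :=
        mul_left_cancel₀ hγ (hmv.trans (hmain w hw hSw).symm)
      have hC := hCC v w hv hw hRR
      have hTT : slackField b13 b14 v = slackField b13 b14 w :=
        eq_of_sq_eq_sq_of_pos_iff (hv.slackField_ne_zero h1 hSv)
          (by rw [hv.slackField_sq, hw.slackField_sq, hC]) hvw.2
      exact hv.eq_of_invariants_of_sign hw h1 h2 hSv hvw.1 hC hTT hRR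
    · rw [Set.encard_univ, ENat.card_eq_coe_fintype_card]
      norm_num
  set P := fieldPolynomial (b13 * b14) (b23 * b24) b34 (b23 ^ 2 + b24 ^ 2)
    (b13 ^ 2 + b14 ^ 2) with hP
  have hP0 : P ≠ 0 := fieldPolynomial_ne_zero hα hβ (h4 hα)
  have hcard : (P.roots.toFinset ×ˢ (Finset.univ : Finset Bool)).card ≤ 8 := by
    have hr := (Multiset.toFinset_card_le P.roots).trans
      (P.card_roots'.trans (fieldPolynomial_natDegree_le _ _ _ _ _))
    rw [Finset.card_product, Finset.card_univ, Fintype.card_bool]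
    lia
  refine (Set.encard_le_encard_of_injOn
    (t := ((P.roots.toFinset ×ˢ (Finset.univ : Finset Bool) : Finset (ℝ × Bool)) :
      Set (ℝ × Bool)))
    (f := fun v => (busTwoField b23 b24 v, decide (0 < phaseSin v))) ?_ ?_).trans ?_
  · rintro v ⟨hv, hS⟩
    have h := hv.field_relation hS
    have hT := hv.slackField_sq
    have hR := hv.busTwoField_sq
    simp only [Finset.coe_product, Set.mem_prod, Finset.mem_coe, Multiset.mem_toFinset,
      Polynomial.mem_roots hP0, Polynomial.IsRoot.def, Finset.mem_univ, and_true]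
    rw [hP]
    simp only [fieldPolynomial, Polynomial.eval_add, Polynomial.eval_mul, Polynomial.eval_C,
      Polynomial.eval_pow, Polynomial.eval_X]
    generalize busTwoField b23 b24 v = R at *
    generalize slackField b13 b14 v = T at *
    generalize b13 * b14 = α at *
    generalize b23 * b24 = β at *
    generalize b23 ^ 2 + b24 ^ 2 = p at *
    generalize b13 ^ 2 + b14 ^ 2 = q at *
    linear_combination α * (β + b34 * R) ^ 2 * hR - β * (β + b34 * R) ^ 2 * hT +
      β * (T * (β + b34 * R) - α * R) * h
  · rintro v ⟨hv, hSv⟩ w ⟨hw, hSw⟩ hvw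
    simp only [Prod.mk.injEq, decide_eq_decide] at hvw
    obtain ⟨hRR, hSS⟩ := hvw
    have hTT : slackField b13 b14 v = slackField b13 b14 w := by
      have hrv := hv.field_relation hSv
      have hrw := hw.field_relation hSw
      have hR := hv.busTwoField_ne_zero h2 hSv
      rw [← hRR] at hrw
      have hne : b23 * b24 + b34 * busTwoField b23 b24 v ≠ 0 := fun h0 =>
        mul_ne_zero hα hR (by linear_combination hrv - slackField b13 b14 v * h0)
      exact mul_left_cancel₀ hne (by linear_combination hrv - hrw)
    exact hv.eq_of_invariants_of_sign hw h1 h2 hSv hSS (hCC v w hv hw hRR) hTT hRR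
  · rw [Set.encard_coe_eq_coe_finsetCard]
    exact_mod_cast hcard

end Real

/-- With `b12 = 0` and zero injections: if the set of complex solutions of the
four-bus system with unity magnitudes is finite, then the system has at most 16
real solutions. -/
theorem stmt14 (b13 b14 b23 b24 b34 : ℝ)
    (hfin : {v : ℂ × ℂ × ℂ × ℂ × ℂ × ℂ |
      PFSysT (0 : ℂ) (b13 : ℂ) (b14 : ℂ) (b23 : ℂ) (b24 : ℂ) (b34 : ℂ)
        0 0 0 v}.Finite) :
    {v : ℝ × ℝ × ℝ × ℝ × ℝ × ℝ |
      PFSysT (0 : ℝ) b13 b14 b23 b24 b34 0 0 0 v}.encard ≤ 16 := by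
  have h1 : ¬ (b13 = 0 ∧ b14 = 0) := fun h =>
    PFSysT.slack_connected hfin (by exact_mod_cast h)
  have h2 : ¬ (b23 = 0 ∧ b24 = 0) := fun h =>
    PFSysT.bus_two_connected hfin (by exact_mod_cast h)
  have h3 : b13 * b14 = 0 → b23 * b24 = 0 → b34 ≠ 0 := fun hα hβ hγ =>
    PFSysT.bridge_ne_zero hfin (by exact_mod_cast hα) (by exact_mod_cast hβ)
      (by exact_mod_cast hγ)
  have h4 : b13 * b14 ≠ 0 → b34 = 0 → b13 * b14 = b23 * b24 →
      b23 ^ 2 + b24 ^ 2 ≠ b13 ^ 2 + b14 ^ 2 := fun hα hγ hαβ hpq => by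
    rw [hγ, Complex.ofReal_zero] at hfin
    exact PFSysT.not_balanced (by exact_mod_cast hα) (by exact_mod_cast hαβ)
      (by exact_mod_cast hpq) hfin
  have h5 : ∀ σ : ℝ, σ ^ 2 = 1 → b13 * σ + b14 = 0 → b23 * σ + b24 ≠ 0 :=
    fun σ hσ hU hW => PFSysT.not_both_degenerate (σ := (σ : ℂ)) hfin (by exact_mod_cast hσ)
      (by exact_mod_cast hU) (by exact_mod_cast hW)
  have hsub : {v | PFSysT (0 : ℝ) b13 b14 b23 b24 b34 0 0 0 v} ⊆
      (trivialSolutions : Set (ℝ × ℝ × ℝ × ℝ × ℝ × ℝ)) ∪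
        {v | PFSysT 0 b13 b14 b23 b24 b34 0 0 0 v ∧ phaseSin v ≠ 0} := fun v hv => by
    by_cases hS : phaseSin v = 0
    · exact Or.inl (PFSysT.mem_trivialSolutions_of_phaseSin_eq_zero hv h1 h2 h5 hS)
    · exact Or.inr ⟨hv, hS⟩
  have htriv : (trivialSolutions : Set (ℝ × ℝ × ℝ × ℝ × ℝ × ℝ)).encard ≤ 8 := by
    rw [Set.encard_coe_eq_coe_finsetCard]
    exact_mod_cast card_trivialSolutions_le
  calc _ ≤ _ := Set.encard_le_encard hsub
    _ ≤ _ := Set.encard_union_le _ _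
    _ ≤ 8 + 8 := add_le_add htriv (PFSysT.encard_nontrivial_le h1 h2 h3 h4)
    _ = 16 := by norm_num
end
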